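/- Let Ω be a simply connected domain in ℂ containing 0, and let 𝒮=(m_k,n_k)_{k≥0} be a sequence of pairs of positive integers such that the sequence (m_k)_{k≥0} is unbounded. Then the set of functions f ∈ H(Ω) such that f ∈ 𝒩_{m_k,n_k} for all k ≥ 0 and the set of poles of all the Padé approximants [f; m_k/n_k], k ≥ 0, is dense in ℂ, is a dense G_δ subset of H(Ω); the same holds for the set of f ∈ H(Ω) such that f ∈ 𝒩_{m_k,n_k} for all k ≥ 0 and the set of zeros of all the [f; m_k/n_k], k ≥ 0, is dense in ℂ. -/

import Mathlib

open Polynomial Filter Finset Metric Topology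

noncomputable section

/-- Coefficient sequence extended to integer indices, with `a k = 0` for `k < 0`. -/
def acoefZ (a : ℕ → ℂ) (k : ℤ) : ℂ := if 0 ≤ k then a k.toNat else 0

/-- The Hankel determinant `C_{m,n} = det (a_{m-n+1+i+j})_{0 ≤ i,j ≤ n-1}`. -/
def hankelDet (a : ℕ → ℂ) (m n : ℕ) : ℂ :=
  Matrix.det (Matrix.of fun i j : Fin n => acoefZ a ((m : ℤ) - n + 1 + i + j))

/-- `IsPade a m n P Q` : the rational function `P/Q` is the Padé approximant of type
`(m,n)` of the formal power series `∑ a_k z^k`. -/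
def IsPade (a : ℕ → ℂ) (m n : ℕ) (P Q : Polynomial ℂ) : Prop :=
  P.natDegree ≤ m ∧ Q.natDegree ≤ n ∧ IsCoprime P Q ∧ Q.coeff 0 = 1 ∧
    ∀ j ≤ m + n, (∑ i ∈ Finset.range (j + 1), Q.coeff i * a (j - i)) = P.coeff j

/-- `𝒟_{m,n}` : the set of coefficient sequences whose Hankel determinant `C_{m,n}`
does not vanish. -/
def Dset (m n : ℕ) : Set (ℕ → ℂ) := {a | hankelDet a m n ≠ 0}

/-- `𝒩_{m,n}` : the subset of `𝒟_{m,n}` of series whose Padé denominator has exact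
degree `n`. -/
def Nset (m n : ℕ) : Set (ℕ → ℂ) :=
  {a | hankelDet a m n ≠ 0 ∧
    ∃ P Q : Polynomial ℂ, IsPade a m n P Q ∧ Q.degree = (n : WithBot ℕ)}

/-- The open unit disc in `ℂ`. -/
def unitD : Set ℂ := Metric.ball (0 : ℂ) 1

/-- The submodule of `ℂ → ℂ` of functions holomorphic on `Ω` (normalized to vanish
outside `Ω`, so that a function is determined by its restriction to `Ω`). -/
def holSubmodule (Ω : Set ℂ) : Submodule ℂ (ℂ → ℂ) where
  carrier := {f | DifferentiableOn ℂ f Ω ∧ ∀ z ∉ Ω, f z = 0}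
  add_mem' := fun hf hg => ⟨hf.1.add hg.1, fun z hz => by simp [hf.2 z hz, hg.2 z hz]⟩
  zero_mem' := ⟨differentiableOn_const 0, fun _ _ => rfl⟩
  smul_mem' := fun c f hf => ⟨hf.1.const_smul c, fun z hz => by simp [hf.2 z hz]⟩

/-- `H(Ω)`, the space of holomorphic functions on `Ω`. -/
abbrev Hol (Ω : Set ℂ) := ↥(holSubmodule Ω)

/-- The topology of uniform convergence on compact subsets of `Ω` on `H(Ω)`. -/
instance holTop (Ω : Set ℂ) : TopologicalSpace (Hol Ω) :=
  TopologicalSpace.induced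
    (fun f : Hol Ω => UniformOnFun.ofFun {K : Set Ω | IsCompact K} fun z : Ω => f.1 z)
    inferInstance

/-- The `k`-th Taylor coefficient at `0` of a function `f`. -/
def tc (f : ℂ → ℂ) (k : ℕ) : ℂ := iteratedDeriv k f 0 / k.factorial

/-- The set of poles of the Padé approximants `[a; m_k/n_k]` for `k ∈ I` : the roots of
the Padé denominators. -/
def padePoles (a : ℕ → ℂ) (m n : ℕ → ℕ) (I : Set ℕ) : Set ℂ :=
  {z | ∃ k ∈ I, ∃ P Q : Polynomial ℂ, IsPade a (m k) (n k) P Q ∧ Q.eval z = 0}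

/-- The set of zeros of the Padé approximants `[a; m_k/n_k]` for `k ∈ I` : the roots of
the Padé numerators. -/
def padeZeros (a : ℕ → ℂ) (m n : ℕ → ℕ) (I : Set ℕ) : Set ℂ :=
  {z | ∃ k ∈ I, ∃ P Q : Polynomial ℂ, IsPade a (m k) (n k) P Q ∧ P.eval z = 0}

/-- The exterior of a closed disc centred at the origin is preconnected. -/
lemma isPreconnected_norm_gt (R : ℝ) (hR : 0 ≤ R) : IsPreconnected {z : ℂ | R < ‖z‖} := by
  have h : {z : ℂ | R < ‖z‖} =
      (fun p : ℝ × ℝ => (p.1 : ℂ) * Complex.exp (p.2 * Complex.I)) '' (Set.Ioi R ×ˢ Set.univ) := by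
    ext z
    constructor
    · intro hz
      exact ⟨(‖z‖, z.arg), ⟨hz, trivial⟩, Complex.norm_mul_exp_arg_mul_I z⟩
    · rintro ⟨⟨r, t⟩, ⟨hr, -⟩, rfl⟩
      simp only [Set.mem_Ioi] at hr
      simp [Complex.norm_exp_ofReal_mul_I, abs_of_pos (hR.trans_lt hr), hr]
  rw [h]
  exact (isPreconnected_Ioi.prod isPreconnected_univ).image _ (by fun_prop)

/-- The function `z ↦ z - w` has no continuous logarithm on a large circle around the origin. -/
lemma no_log_on_circle (w : ℂ) (R : ℝ) (hR : ‖w‖ < R) (F : ℂ → ℂ) (hF : Continuous F)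
    (h : ∀ z : ℂ, R ≤ ‖z‖ → Complex.exp (F z) = z - w) : False := by
  have hR0 : 0 < R + ‖w‖ := by linarith [norm_nonneg w]
  set ρ : ℝ := R + ‖w‖ with hρ
  set g : ℝ → ℂ := fun t => F (w + ρ * Complex.exp (t * Complex.I)) - t * Complex.I with hg
  have hgc : Continuous g := by fun_prop
  have hexp : ∀ t : ℝ, Complex.exp (g t) = ρ := by
    intro t
    have hn : R ≤ ‖w + ρ * Complex.exp (t * Complex.I)‖ := by
      have h1 : ‖(ρ : ℂ) * Complex.exp (t * Complex.I)‖ = ρ := by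
        simp [Complex.norm_exp_ofReal_mul_I, abs_of_pos hR0]
      have h2 := norm_sub_le (w + ρ * Complex.exp (t * Complex.I)) w
      rw [add_sub_cancel_left, h1] at h2
      linarith
    rw [hg]
    simp only
    rw [Complex.exp_sub, h _ hn, add_sub_cancel_left, mul_div_assoc,
      div_self (Complex.exp_ne_zero _), mul_one]
  have hconst : ∀ t, Complex.exp (g t) = Complex.exp (g 0) := fun t => by rw [hexp, hexp]
  have him : ∀ t : ℝ, ∃ k : ℤ, (((g t - g 0) / (2 * Real.pi * Complex.I)).re) = (k : ℝ) := by
    intro t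
    obtain ⟨k, hk⟩ := Complex.exp_eq_exp_iff_exists_int.1 (hconst t)
    refine ⟨k, ?_⟩
    have : (g t - g 0) / (2 * Real.pi * Complex.I) = (k : ℂ) := by
      rw [hk, add_sub_cancel_left, mul_div_assoc, div_self Complex.two_pi_I_ne_zero, mul_one]
    rw [this]
    simp
  choose k hk using him
  have hkc : Continuous k := by
    rw [Int.isClosedEmbedding_coe_real.isInducing.continuous_iff]
    have : (fun x : ℤ => (x : ℝ)) ∘ k =
        fun t => (((g t - g 0) / (2 * Real.pi * Complex.I)).re) := by
      ext t; simp [hk]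
    rw [this]
    fun_prop
  have hk0 : k (2 * Real.pi) = k 0 := (PreconnectedSpace.constant inferInstance hkc)
  have h2 : g (2 * Real.pi) = g 0 := by
    obtain ⟨l, hl⟩ := Complex.exp_eq_exp_iff_exists_int.1 (hconst (2 * Real.pi))
    have e1 := hk (2 * Real.pi)
    have e0 := hk 0
    rw [hk0, ← e0, hl, add_sub_cancel_left, mul_div_assoc,
      div_self Complex.two_pi_I_ne_zero, mul_one, sub_self, zero_div] at e1
    have : l = 0 := by simpa using e1
    rw [hl, this]
    simp
  simp only [hg] at h2
  push_cast at h2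
  rw [Complex.exp_two_pi_mul_I] at h2
  simp at h2

/-- Every nowhere vanishing continuous function on a simply connected, locally path connected
space has a continuous logarithm. -/
lemma exists_continuous_log {A : Type*} [TopologicalSpace A] [SimplyConnectedSpace A]
    [LocallyPathConnectedSpace A] (f : C(A, ℂ)) (hf : ∀ a, f a ≠ 0) :
    ∃ F : C(A, ℂ), ∀ a, Complex.exp (F a) = f a := by
  obtain ⟨a₀⟩ : Nonempty A := inferInstance
  obtain ⟨F, ⟨-, hF⟩, -⟩ := Complex.isCoveringMapOn_exp.existsUnique_continuousMap_lifts f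
    (a₀ := a₀) (e₀ := Complex.log (f a₀)) (Complex.exp_log (hf a₀)) (fun a => hf a)
  exact ⟨F, fun a => congrFun hF a⟩

/-- A compact subset of a simply connected open set does not separate the points outside the
open set from infinity. -/
lemma mem_component_of_notMem {Ω : Set ℂ} (hΩo : IsOpen Ω) (hΩsc : SimplyConnectedSpace Ω)
    {K V : Set ℂ} (hK : IsCompact K) (hKΩ : K ⊆ Ω) {R : ℝ} (hV : IsOpen V)
    (hVR : {z : ℂ | R < ‖z‖} ⊆ V) (hU : IsOpen (V ∪ K)ᶜ) {w : ℂ} (hw : w ∉ Ω) : w ∈ V := by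
  classical
  by_contra hwV
  have hwK : w ∉ K := fun h => hw (hKΩ h)
  have : LocallyPathConnectedSpace Ω := hΩo.locallyPathConnectedSpace
  obtain ⟨L, hL⟩ := exists_continuous_log (A := Ω) ⟨fun z => (z : ℂ) - w, by fun_prop⟩
    (fun a h => hw (by rw [← sub_eq_zero.1 h]; exact a.2))
  let LK : C(K, ℂ) := ⟨fun z => L ⟨z, hKΩ z.2⟩, by fun_prop⟩
  obtain ⟨M, hM⟩ := ContinuousMap.exists_restrict_eq hK.isClosed LK
  have hMK : ∀ z ∈ K, Complex.exp (M z) = z - w := by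
    intro z hz
    have := congrArg (fun φ => φ ⟨z, hz⟩) hM
    simp only [ContinuousMap.restrict_apply] at this
    rw [this]
    exact hL ⟨z, hKΩ hz⟩
  let h : ℂ → ℂ := fun z => if z ∈ V then z - w else Complex.exp (M z)
  have h1 : ∀ z ∈ V ∪ K, h z = z - w := by
    intro z hz
    by_cases hzV : z ∈ V
    · simp [h, hzV]
    · simp only [h, hzV, if_false]
      exact hMK z (hz.resolve_left hzV)
  have h2 : ∀ z ∈ Vᶜ, h z = Complex.exp (M z) := fun z hz => by
    simp only [h, if_neg hz]
  have hc1 : IsClosed (V ∪ K) := ⟨hU⟩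
  have hc : Continuous h := by
    rw [← continuousOn_univ]
    have : (Set.univ : Set ℂ) = (V ∪ K) ∪ Vᶜ := by
      ext z; by_cases hz : z ∈ V <;> simp [hz]
    rw [this]
    refine ContinuousOn.union_of_isClosed ?_ ?_ hc1 hV.isClosed_compl
    · exact ContinuousOn.congr (by fun_prop) h1
    · exact ContinuousOn.congr (f := fun z => Complex.exp (M z)) (by fun_prop) h2
  have hne : ∀ z, h z ≠ 0 := by
    intro z
    by_cases hz : z ∈ V
    · rw [h1 z (Or.inl hz)]
      intro h0
      exact hwV (by rwa [← sub_eq_zero.1 h0])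
    · rw [h2 z hz]
      exact Complex.exp_ne_zero _
  obtain ⟨F, hF⟩ := exists_continuous_log ⟨h, hc⟩ hne
  refine no_log_on_circle w (max R ‖w‖ + 1) (by linarith [le_max_right R ‖w‖]) F F.continuous ?_
  intro z hz
  rw [hF z]
  exact h1 z (Or.inl (hVR (by
    simp only [Set.mem_ofPred_eq]; linarith [le_max_left R ‖w‖])))

/-- Every compact subset of a simply connected open set in the plane is contained in a compact
subset whose complement is connected. -/
lemma exists_compact_connected_compl {Ω : Set ℂ} (hΩo : IsOpen Ω)
    (hΩsc : SimplyConnectedSpace Ω) {K : Set ℂ} (hK : IsCompact K) (hKΩ : K ⊆ Ω) :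
    ∃ K' : Set ℂ, IsCompact K' ∧ K ⊆ K' ∧ K' ⊆ Ω ∧ IsPreconnected K'ᶜ := by
  obtain ⟨R₀, hR₀⟩ := hK.isBounded.exists_norm_le
  set R := max R₀ 0
  have hext : {z : ℂ | R < ‖z‖} ⊆ Kᶜ := fun z hz hzK =>
    absurd (hR₀ z hzK) (not_le.2 ((le_max_left _ _).trans_lt hz))
  have hx0 : ((R + 1 : ℝ) : ℂ) ∈ {z : ℂ | R < ‖z‖} := by
    have : 0 ≤ R := le_max_right _ _
    simp only [Set.mem_ofPred_eq, Complex.norm_real, Real.norm_eq_abs]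
    rw [abs_of_pos (by linarith)]
    linarith
  set V := connectedComponentIn Kᶜ ((R + 1 : ℝ) : ℂ) with hVdef
  have hKc : IsOpen Kᶜ := hK.isClosed.isOpen_compl
  have hV : IsOpen V := hKc.connectedComponentIn
  have hVR : {z : ℂ | R < ‖z‖} ⊆ V :=
    (isPreconnected_norm_gt R (le_max_right _ _)).subset_connectedComponentIn hx0 hext
  have hVK : V ⊆ Kᶜ := connectedComponentIn_subset _ _
  have hU : IsOpen (V ∪ K)ᶜ := by
    rw [isOpen_iff_mem_nhds]
    intro z hz
    simp only [Set.mem_compl_iff, Set.mem_union, not_or] at hz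
    have hz' : z ∈ connectedComponentIn Kᶜ z := mem_connectedComponentIn hz.2
    refine Filter.mem_of_superset (hKc.connectedComponentIn.mem_nhds hz') ?_
    intro y hy
    simp only [Set.mem_compl_iff, Set.mem_union, not_or]
    refine ⟨fun hyV => hz.1 ?_, connectedComponentIn_subset _ _ hy⟩
    have e1 := connectedComponentIn_eq hy
    have e2 := connectedComponentIn_eq hyV
    rw [hVdef, e2, ← e1]
    exact hz'
  refine ⟨Vᶜ, ?_, fun z hz hzV => hVK hzV hz, ?_, ?_⟩
  · refine Metric.isCompact_of_isClosed_isBounded hV.isClosed_compl ?_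
    refine (Metric.isBounded_closedBall (x := (0 : ℂ)) (r := R)).subset fun z hz => ?_
    rw [mem_closedBall_zero_iff]
    by_contra hlt
    exact hz (hVR (not_le.1 hlt))
  · intro z hz
    by_contra hzΩ
    exact hz (mem_component_of_notMem hΩo hΩsc hK hKΩ hV hVR hU hzΩ)
  · rw [compl_compl]
    exact isPreconnected_connectedComponentIn

open MeasureTheory in
/-- A continuous function on the plane that vanishes for large radii is integrable on a
half-strip. -/
lemma integrable_half_strip (A : ℝ × ℝ → ℂ) (hA : Continuous A) (R : ℝ)
    (h : ∀ p : ℝ × ℝ, R < p.1 → A p = 0) :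
    IntegrableOn A (Set.Ioi (0 : ℝ) ×ˢ Set.Ioo (-Real.pi) Real.pi) := by
  have h1 : IntegrableOn A (Set.Icc (0 : ℝ) R ×ˢ Set.Icc (-Real.pi) Real.pi) :=
    hA.continuousOn.integrableOn_compact (isCompact_Icc.prod isCompact_Icc)
  refine h1.of_forall_sdiff_eq_zero (measurableSet_Ioi.prod measurableSet_Ioo) ?_
  rintro ⟨r, t⟩ ⟨⟨hr, ht⟩, h2⟩
  apply h
  by_contra hlt
  exact h2 ⟨⟨le_of_lt hr, not_lt.1 hlt⟩, ⟨ht.1.le, ht.2.le⟩⟩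

/-- Twice the Cauchy–Riemann operator. -/
def dbar (g : ℂ → ℂ) (z : ℂ) : ℂ := fderiv ℝ g z 1 + Complex.I * fderiv ℝ g z Complex.I

open MeasureTheory in
/-- The Cauchy–Pompeiu formula at the origin for a compactly supported function. -/
lemma integral_dbar_div (g : ℂ → ℂ) (hg : ContDiff ℝ 1 g) (hs : HasCompactSupport g) :
    ∫ z : ℂ, dbar g z / z = -(2 * Real.pi * g 0) := by
  obtain ⟨R₀, hR₀⟩ := hs.isCompact.isBounded.exists_norm_le
  set R : ℝ := max R₀ 0
  have hcf : Continuous (fderiv ℝ g) := hg.continuous_fderiv one_ne_zero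
  have hdiff : Differentiable ℝ g := hg.differentiable one_ne_zero
  set e : ℝ → ℂ := fun t => Complex.exp (t * Complex.I) with he
  have hec : Continuous e := by fun_prop
  have hen : ∀ t, ‖e t‖ = 1 := fun t => Complex.norm_exp_ofReal_mul_I t
  have hfz : ∀ z : ℂ, R < ‖z‖ → fderiv ℝ g z = 0 := by
    intro z hz
    by_contra hne
    have : z ∈ tsupport g := support_fderiv_subset ℝ hne
    exact absurd (hR₀ z this) (not_le.2 ((le_max_left _ _).trans_lt hz))
  have hnr : ∀ p : ℝ × ℝ, R < p.1 → R < ‖(p.1 : ℂ) * e p.2‖ := by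
    intro p hp
    rw [norm_mul, hen, mul_one, Complex.norm_real, Real.norm_eq_abs]
    exact hp.trans_le (le_abs_self _)
  let A : ℝ × ℝ → ℂ := fun p => fderiv ℝ g (p.1 * e p.2) (e p.2)
  let B : ℝ × ℝ → ℂ := fun p => fderiv ℝ g (p.1 * e p.2) (Complex.I * e p.2)
  have hAc : Continuous A := by
    refine Continuous.clm_apply (hcf.comp (by fun_prop)) (by fun_prop)
  have hBc : Continuous B := by
    refine Continuous.clm_apply (hcf.comp (by fun_prop)) (by fun_prop)
  have hA0 : ∀ p : ℝ × ℝ, R < p.1 → A p = 0 := fun p hp => by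
    simp [A, hfz _ (hnr p hp)]
  have hB0 : ∀ p : ℝ × ℝ, R < p.1 → B p = 0 := fun p hp => by
    simp [B, hfz _ (hnr p hp)]
  have hAi := integrable_half_strip A hAc R hA0
  have hBi := integrable_half_strip B hBc R hB0
  have hpt : ∀ p ∈ polarCoord.target,
      p.1 • (dbar g (Complex.polarCoord.symm p) / Complex.polarCoord.symm p) =
        A p + Complex.I * B p := by
    rintro ⟨r, t⟩ ⟨hr, -⟩
    have hr' : (r : ℂ) ≠ 0 := Complex.ofReal_ne_zero.2 (ne_of_gt hr)
    have hsymm : Complex.polarCoord.symm (r, t) = r * e t := by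
      rw [Complex.polarCoord_symm_apply, he]
      simp only [Complex.exp_mul_I, Complex.ofReal_cos, Complex.ofReal_sin]
    have hee : e t = Real.cos t + Real.sin t * Complex.I := by
      simp only [he, Complex.exp_mul_I, Complex.ofReal_cos, Complex.ofReal_sin]
    have hA' : A (r, t) = Real.cos t * fderiv ℝ g (r * e t) 1
        + Real.sin t * fderiv ℝ g (r * e t) Complex.I := by
      have h1 : e t = Real.cos t • (1 : ℂ) + Real.sin t • Complex.I := by
        rw [hee]; simp
      simp only [A]
      conv_lhs => arg 2; rw [h1]
      rw [map_add, map_smul, map_smul]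
      simp
    have hB' : B (r, t) = -Real.sin t * fderiv ℝ g (r * e t) 1
        + Real.cos t * fderiv ℝ g (r * e t) Complex.I := by
      have h1 : Complex.I * e t = (-Real.sin t) • (1 : ℂ) + Real.cos t • Complex.I := by
        rw [hee]
        simp only [Complex.real_smul]
        push_cast
        linear_combination (Complex.sin t : ℂ) * Complex.I_mul_I
      simp only [B]
      rw [h1, map_add, map_smul, map_smul]
      simp
    have hcs : (Real.cos t : ℂ) ^ 2 + (Real.sin t : ℂ) ^ 2 = 1 := by
      rw [← Complex.ofReal_pow, ← Complex.ofReal_pow, ← Complex.ofReal_add, Real.cos_sq_add_sin_sq,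
        Complex.ofReal_one]
    have he0 : e t ≠ 0 := Complex.exp_ne_zero _
    rw [hsymm, hA', hB', Complex.real_smul, dbar]
    simp only
    rw [← mul_div_assoc, mul_div_mul_left _ _ hr', div_eq_iff he0, hee]
    linear_combination (-fderiv ℝ g (r * (Real.cos t + Real.sin t * Complex.I)) 1
      - Complex.I * fderiv ℝ g (r * (Real.cos t + Real.sin t * Complex.I)) Complex.I) * hcs
      + (Real.sin t ^ 2 * fderiv ℝ g (r * (Real.cos t + Real.sin t * Complex.I)) 1
      - Real.sin t * Real.cos t *
        fderiv ℝ g (r * (Real.cos t + Real.sin t * Complex.I)) Complex.I) * Complex.I_mul_I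
  have hAint : ∫ p in Set.Ioi (0 : ℝ) ×ˢ Set.Ioo (-Real.pi) Real.pi, A p =
      -(2 * Real.pi * g 0) := by
    rw [Measure.volume_eq_prod, ← Measure.prod_restrict, integral_prod_symm]
    · have hin : ∀ t : ℝ, ∫ r in Set.Ioi (0 : ℝ), A (r, t) = -g 0 := by
        intro t
        have hγ : ContDiff ℝ 1 (fun r : ℝ => g (r * e t)) :=
          hg.comp ((Complex.ofRealCLM.contDiff).mul contDiff_const)
        have hγs : HasCompactSupport (fun r : ℝ => g (r * e t)) := by
          refine HasCompactSupport.intro (isCompact_Icc (a := -R) (b := R)) ?_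
          intro r hr
          have hr' : R < |r| := by
            by_contra hlt
            exact hr (abs_le.1 (not_lt.1 hlt))
          by_contra hne
          have h2 := hR₀ _ (subset_tsupport _ hne)
          rw [norm_mul, hen, mul_one, Complex.norm_real, Real.norm_eq_abs] at h2
          exact absurd h2 (not_le.2 ((le_max_left _ _).trans_lt hr'))
        have hd : ∀ r : ℝ, deriv (fun r : ℝ => g (r * e t)) r = A (r, t) := by
          intro r
          have h1 : HasDerivAt (fun r : ℝ => (r : ℂ) * e t) (e t) r := by
            simpa using (Complex.ofRealCLM.hasDerivAt (x := r)).mul_const (e t)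
          exact ((hdiff _).hasFDerivAt.comp_hasDerivAt r h1).deriv
        have := hγs.integral_Ioi_deriv_eq hγ 0
        simp only [hd] at this
        simpa using this
      simp only [hin]
      rw [setIntegral_const]
      simp only [Measure.real, Real.volume_Ioo, sub_neg_eq_add]
      rw [ENNReal.toReal_ofReal (by positivity), Complex.real_smul]
      push_cast
      ring
    · rw [Measure.prod_restrict, ← Measure.volume_eq_prod]
      exact hAi
  have hBint : ∫ p in Set.Ioi (0 : ℝ) ×ˢ Set.Ioo (-Real.pi) Real.pi, B p = 0 := by
    rw [Measure.volume_eq_prod, ← Measure.prod_restrict, integral_prod]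
    · have hin : ∀ r ∈ Set.Ioi (0 : ℝ), ∫ t in Set.Ioo (-Real.pi) Real.pi, B (r, t) = 0 := by
        intro r hr
        have hr0 : (r : ℝ) ≠ 0 := ne_of_gt hr
        have hd : ∀ t : ℝ, HasDerivAt (fun t : ℝ => g (r * e t)) (r • B (r, t)) t := by
          intro t
          have h1 : HasDerivAt (fun t : ℝ => (r : ℂ) * e t) (r * (e t * Complex.I)) t := by
            have h2 : HasDerivAt (fun t : ℝ => (t : ℂ) * Complex.I) Complex.I t := by
              simpa using (Complex.ofRealCLM.hasDerivAt (x := t)).mul_const Complex.I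
            exact h2.cexp.const_mul _
          have h3 := (hdiff _).hasFDerivAt.comp_hasDerivAt t h1
          have h4 : (r : ℂ) * (e t * Complex.I) = r • (Complex.I * e t) := by
            rw [Complex.real_smul]; ring
          rw [h4, map_smul] at h3
          exact h3
        have hcB : Continuous fun t : ℝ => r • B (r, t) := by fun_prop
        have h5 := intervalIntegral.integral_eq_sub_of_hasDerivAt
          (a := -Real.pi) (b := Real.pi) (fun t _ => hd t) (hcB.intervalIntegrable _ _)
        have hπ : e Real.pi = e (-Real.pi) := by
          simp [he, Complex.exp_neg]
        rw [hπ, sub_self, intervalIntegral.integral_smul, smul_eq_zero_iff_right hr0,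
          intervalIntegral.integral_of_le (by linarith [Real.pi_pos]),
          integral_Ioc_eq_integral_Ioo] at h5
        exact h5
      rw [setIntegral_congr_fun measurableSet_Ioi hin]
      simp
    · rw [Measure.prod_restrict, ← Measure.volume_eq_prod]
      exact hBi
  rw [← Complex.integral_comp_polarCoord_symm,
    setIntegral_congr_fun polarCoord.open_target.measurableSet hpt, polarCoord_target,
    integral_add hAi (hBi.const_mul _), integral_const_mul, hAint, hBint]
  simp

open MeasureTheory in
/-- The Cauchy–Pompeiu formula for a compactly supported function. -/
lemma integral_dbar_div_sub (g : ℂ → ℂ) (hg : ContDiff ℝ 1 g) (hs : HasCompactSupport g) (z : ℂ) :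
    ∫ ζ : ℂ, dbar g ζ / (ζ - z) = -(2 * Real.pi * g z) := by
  have h := integral_dbar_div (fun ζ => g (ζ + z)) (hg.comp (contDiff_id.add contDiff_const))
    (hs.comp_homeomorph (Homeomorph.addRight z))
  have h2 : ∀ ζ, dbar (fun ζ => g (ζ + z)) ζ = dbar g (ζ + z) := by
    intro ζ
    simp only [dbar, fderiv_comp_add_right]
  simp only [h2, zero_add] at h
  rw [← h, ← integral_add_right_eq_self (fun ζ => dbar g ζ / (ζ - z)) z]
  simp

/-- The operator `dbar` kills functions that are holomorphic near the point. -/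
lemma dbar_eq_zero {g f : ℂ → ℂ} {z : ℂ} (h : g =ᶠ[𝓝 z] f) (hf : DifferentiableAt ℂ f z) :
    dbar g z = 0 := by
  have h1 : fderiv ℝ g z = (fderiv ℂ f z).restrictScalars ℝ := by
    rw [h.fderiv_eq]
    exact hf.fderiv_restrictScalars ℝ
  have h2 : fderiv ℂ f z Complex.I = Complex.I * fderiv ℂ f z 1 := by
    rw [← smul_eq_mul, ← map_smul, smul_eq_mul, mul_one]
  rw [dbar, h1, ContinuousLinearMap.coe_restrictScalars', h2, ← mul_assoc, Complex.I_mul_I]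
  ring

/-- A smooth compactly supported modification of a holomorphic function away from a compact
set. -/
lemma exists_contDiff_eq_nhds {Ω K : Set ℂ} (hΩ : IsOpen Ω) (hK : IsCompact K) (hKΩ : K ⊆ Ω)
    {f : ℂ → ℂ} (hf : DifferentiableOn ℂ f Ω) :
    ∃ g : ℂ → ℂ, ContDiff ℝ 1 g ∧ HasCompactSupport g ∧ ∀ z ∈ K, g =ᶠ[𝓝 z] f := by
  obtain ⟨t, ht, hKt, htΩ⟩ := exists_compact_between hK hΩ hKΩ
  obtain ⟨φ, h1, h0, -⟩ := exists_contMDiffMap_one_nhds_of_subset_interior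
    (n := 1) (modelWithCornersSelf ℝ ℂ) hK.isClosed hKt
  have hφ : ContDiff ℝ 1 φ := φ.contMDiff.contDiff
  refine ⟨fun z => φ z * f z, ?_, HasCompactSupport.intro ht fun z hz => by simp [h0 z hz], ?_⟩
  · rw [contDiff_iff_contDiffAt]
    intro z
    by_cases hz : z ∈ Ω
    · have h2 : ContDiffAt ℝ 1 f z :=
        ((hf.analyticAt (hΩ.mem_nhds hz)).contDiffAt).restrict_scalars ℝ
      have h3 : ContDiffAt ℝ 1 (fun z => (φ z : ℂ)) z :=
        Complex.ofRealCLM.contDiff.contDiffAt.comp z hφ.contDiffAt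
      exact h3.mul h2
    · have h2 : (fun z => (φ z : ℂ) * f z) =ᶠ[𝓝 z] fun _ => 0 := by
        filter_upwards [ht.isClosed.isOpen_compl.mem_nhds fun h => hz (htΩ h)] with y hy
        simp [h0 y hy]
      exact contDiffAt_const.congr_of_eventuallyEq h2
  · intro z hz
    have h2 : ∀ᶠ x in 𝓝 z, φ x = 1 := h1.filter_mono (nhds_le_nhdsSet hz)
    filter_upwards [h2] with y hy
    simp [hy]

open MeasureTheory in
/-- Runge's theorem: a function holomorphic near a compact set with connected complement is
uniformly approximable by polynomials on that set. -/
theorem runge_polynomial {Ω K : Set ℂ} (hΩ : IsOpen Ω) (hK : IsCompact K) (hKΩ : K ⊆ Ω)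
    (hKc : IsPreconnected Kᶜ) {f : ℂ → ℂ} (hf : DifferentiableOn ℂ f Ω) {ε : ℝ} (hε : 0 < ε) :
    ∃ p : ℂ[X], ∀ z ∈ K, ‖p.eval z - f z‖ < ε := by
  obtain ⟨g, hg, hgs, hgf⟩ := exists_contDiff_eq_nhds hΩ hK hKΩ hf
  have : CompactSpace K := isCompact_iff_compactSpace.1 hK
  let S : Subalgebra ℂ C(K, ℂ) := (polynomialFunctions K).topologicalClosure
  have hSc : IsClosed (S : Set C(K, ℂ)) := Subalgebra.isClosed_topologicalClosure _
  have : CompleteSpace S := hSc.completeSpace_coe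
  let x : S := ⟨Polynomial.toContinuousMapOnAlgHom K X, Subalgebra.le_topologicalClosure _ (by
    rw [← SetLike.mem_coe, polynomialFunctions_coe]; exact ⟨X, rfl⟩)⟩
  have hxv : ∀ z : K, (x : C(K, ℂ)) z = z := fun z => by simp [x]
  have hspecA : spectrum ℂ (x : C(K, ℂ)) = K := by
    rw [ContinuousMap.spectrum_eq_range]
    ext z
    constructor
    · rintro ⟨y, rfl⟩
      rw [hxv]; exact y.2
    · intro hz
      exact ⟨⟨z, hz⟩, hxv _⟩
  have hspec : spectrum ℂ x = K := by
    rw [Subalgebra.spectrum_eq_of_isPreconnected_compl S x (by rwa [hspecA]), hspecA]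
  have hunit : ∀ ζ ∉ K, IsUnit (algebraMap ℂ S ζ - x) := by
    intro ζ hζ
    rw [← hspec] at hζ
    exact spectrum.notMem_iff.1 hζ
  have hval : ∀ ζ ∉ K, ∀ z : K, ((Ring.inverse (algebraMap ℂ S ζ - x) : S) : C(K, ℂ)) z =
      (ζ - z)⁻¹ := by
    intro ζ hζ z
    have h1 := Ring.mul_inverse_cancel _ (hunit ζ hζ)
    have h2 := congrArg (fun s : S => (s : C(K, ℂ)) z) h1
    simp only [MulMemClass.coe_mul, ContinuousMap.mul_apply, AddSubgroupClass.coe_sub,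
      ContinuousMap.sub_apply, hxv, OneMemClass.coe_one, ContinuousMap.one_apply] at h2
    have h3 : ((algebraMap ℂ S ζ : S) : C(K, ℂ)) z = ζ := rfl
    rw [h3] at h2
    exact eq_inv_of_mul_eq_one_right h2
  have hdb : ∀ z ∈ K, ∀ᶠ ζ in 𝓝 z, dbar g ζ = 0 := by
    intro z hz
    filter_upwards [(hgf z hz).eventually_nhds, hΩ.mem_nhds (hKΩ hz)] with ζ h1 h2
    exact dbar_eq_zero h1 (hf.differentiableAt (hΩ.mem_nhds h2))
  have hdbc : Continuous (dbar g) := by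
    have := hg.continuous_fderiv one_ne_zero
    unfold dbar
    fun_prop
  let F : ℂ → S := fun ζ => dbar g ζ • Ring.inverse (algebraMap ℂ S ζ - x)
  have hFc : Continuous F := by
    rw [continuous_iff_continuousAt]
    intro ζ
    by_cases hζ : ζ ∈ K
    · have : F =ᶠ[𝓝 ζ] fun _ => 0 := by
        filter_upwards [hdb ζ hζ] with y hy
        simp [F, hy]
      exact continuousAt_const.congr this.symm
    · refine hdbc.continuousAt.smul ?_
      obtain ⟨u, hu⟩ := hunit ζ hζ
      have h1 := NormedRing.inverse_continuousAt u
      rw [hu] at h1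
      refine ContinuousAt.comp (f := fun ζ => algebraMap ℂ S ζ - x) h1 ?_
      exact ((continuous_algebraMap ℂ S).sub continuous_const).continuousAt
  have hFs : HasCompactSupport F := by
    refine HasCompactSupport.intro (hgs.isCompact) fun ζ hζ => ?_
    have : fderiv ℝ g ζ = 0 := by
      by_contra hne
      exact hζ (support_fderiv_subset ℝ hne)
    simp [F, dbar, this]
  have hFi : Integrable F := hFc.integrable_of_hasCompactSupport hFs
  let s : S := ∫ ζ, F ζ
  have hs : ∀ z : K, (s : C(K, ℂ)) z = -(2 * Real.pi * f z) := by
    intro z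
    let ev : S →L[ℂ] ℂ := (ContinuousMap.evalCLM ℂ z).comp S.toSubmodule.subtypeL
    have h1 : ev s = ∫ ζ, ev (F ζ) := (ev.integral_comp_comm hFi).symm
    have h2 : ∀ ζ, ev (F ζ) = dbar g ζ / (ζ - z) := by
      intro ζ
      have h3 : ev (F ζ) =
        dbar g ζ * ((Ring.inverse (algebraMap ℂ S ζ - x) : S) : C(K, ℂ)) z := rfl
      rw [h3]
      by_cases hζ : ζ ∈ K
      · rw [(hdb ζ hζ).self_of_nhds]; simp
      · rw [hval ζ hζ, div_eq_mul_inv]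
    simp only [h2] at h1
    rw [integral_dbar_div_sub g hg hgs z, (hgf z z.2).eq_of_nhds] at h1
    exact h1
  have hπ : (2 * Real.pi : ℂ) ≠ 0 := by
    simp [Real.pi_ne_zero]
  let s' : S := (-(2 * Real.pi : ℂ)⁻¹) • s
  have hs' : ∀ z : K, (s' : C(K, ℂ)) z = f z := by
    intro z
    have h3 : (s' : C(K, ℂ)) z = (-(2 * Real.pi : ℂ)⁻¹) * (s : C(K, ℂ)) z := rfl
    rw [h3, hs]
    field_simp
  have hmem : (s' : C(K, ℂ)) ∈ closure (polynomialFunctions K : Set C(K, ℂ)) := by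
    rw [← Subalgebra.topologicalClosure_coe]
    exact s'.2
  obtain ⟨q, hq, hd⟩ := Metric.mem_closure_iff.1 hmem ε hε
  rw [polynomialFunctions_coe] at hq
  obtain ⟨p, rfl⟩ := hq
  refine ⟨p, fun z hz => ?_⟩
  have h4 := (ContinuousMap.dist_lt_iff hε).1 hd ⟨z, hz⟩
  rw [hs', dist_comm, dist_eq_norm] at h4
  simpa using h4

/-- A holomorphic function as a continuous map on its domain. -/
def Hol.toContinuousMap {Ω : Set ℂ} (f : Hol Ω) : C(Ω, ℂ) :=
  ⟨fun z => f.1 z, f.2.1.continuousOn.domRestrict⟩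

@[simp]
lemma Hol.toContinuousMap_apply {Ω : Set ℂ} (f : Hol Ω) (z : Ω) : f.toContinuousMap z = f.1 z :=
  rfl

lemma Hol.isInducing_toContinuousMap (Ω : Set ℂ) :
    IsInducing (Hol.toContinuousMap : Hol Ω → C(Ω, ℂ)) := by
  have h1 : IsInducing (fun f : Hol Ω =>
      UniformOnFun.ofFun {K : Set Ω | IsCompact K} fun z : Ω => f.1 z) := ⟨rfl⟩
  exact (ContinuousMap.isUniformEmbedding_toUniformOnFunIsCompact.isInducing.of_comp_iff).1 h1

lemma Hol.isClosed_range_toContinuousMap {Ω : Set ℂ} (hΩ : IsOpen Ω) :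
    IsClosed (Set.range (Hol.toContinuousMap : Hol Ω → C(Ω, ℂ))) := by
  classical
  have : LocallyCompactSpace Ω := hΩ.locallyCompactSpace
  rw [isClosed_iff_forall_filter]
  intro φ u hu hule hφ
  have hloc := ContinuousMap.tendsto_iff_tendstoLocallyUniformly.1 (hφ : Tendsto id u (𝓝 φ))
  let ext : C(Ω, ℂ) → ℂ → ℂ := fun ψ z => if h : z ∈ Ω then ψ ⟨z, h⟩ else 0
  have hloc' : TendstoLocallyUniformlyOn ext (ext φ) u Ω := by
    rw [tendstoLocallyUniformlyOn_iff_tendstoLocallyUniformly_comp_coe]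
    convert hloc using 2
    · ext z; simp [ext]
    · ext z; simp [ext]
  have hd : DifferentiableOn ℂ (ext φ) Ω := by
    refine hloc'.differentiableOn ?_ hΩ
    have : ∀ᶠ ψ in u, ψ ∈ Set.range (Hol.toContinuousMap : Hol Ω → C(Ω, ℂ)) :=
      hule (mem_principal_self _)
    filter_upwards [this] with ψ hψ
    obtain ⟨f, rfl⟩ := hψ
    exact f.2.1.congr fun z hz => by simp [ext, hz]
  refine ⟨⟨ext φ, hd, fun z hz => by simp [ext, hz]⟩, ?_⟩
  ext z
  simp [ext]

lemma Hol.injective_toContinuousMap (Ω : Set ℂ) :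
    Function.Injective (Hol.toContinuousMap : Hol Ω → C(Ω, ℂ)) := by
  intro f g h
  ext z
  by_cases hz : z ∈ Ω
  · exact congrArg (fun ψ => ψ ⟨z, hz⟩) h
  · rw [f.2.2 z hz, g.2.2 z hz]

lemma Hol.baireSpace {Ω : Set ℂ} (hΩ : IsOpen Ω) : BaireSpace (Hol Ω) := by
  have : LocallyCompactSpace Ω := hΩ.locallyCompactSpace
  have he : IsClosedEmbedding (Hol.toContinuousMap : Hol Ω → C(Ω, ℂ)) :=
    ⟨⟨Hol.isInducing_toContinuousMap Ω, Hol.injective_toContinuousMap Ω⟩,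
      Hol.isClosed_range_toContinuousMap hΩ⟩
  let : UniformSpace (Hol Ω) := UniformSpace.comap Hol.toContinuousMap inferInstance
  have hu : IsUniformInducing (Hol.toContinuousMap : Hol Ω → C(Ω, ℂ)) := ⟨rfl⟩
  have h1 : CompleteSpace (Hol Ω) := by
    rw [completeSpace_iff_isComplete_range hu]
    exact (Hol.isClosed_range_toContinuousMap hΩ).isComplete
  have h2 : (uniformity (Hol Ω)).IsCountablyGenerated := by
    exact Filter.comap.isCountablyGenerated _ _
  have h3 : holTop Ω = UniformSpace.toTopologicalSpace := by
    rw [he.isInducing.eq_induced]; rfl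
  rw [h3]
  infer_instance

lemma continuous_tc {Ω : Set ℂ} (hΩ : IsOpen Ω) (h0 : (0 : ℂ) ∈ Ω) :
    Continuous fun f : Hol Ω => tc f.1 := by
  have : LocallyCompactSpace Ω := hΩ.locallyCompactSpace
  refine continuous_pi fun k => ?_
  refine Continuous.div_const ?_ _
  rw [continuous_iff_continuousAt]
  intro f
  have h1 : Tendsto Hol.toContinuousMap (𝓝 f) (𝓝 f.toContinuousMap) :=
    (Hol.isInducing_toContinuousMap Ω).continuous.continuousAt
  have h2 : TendstoLocallyUniformlyOn (fun g : Hol Ω => g.1) f.1 (𝓝 f) Ω := by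
    rw [tendstoLocallyUniformlyOn_iff_tendstoLocallyUniformly_comp_coe]
    exact ContinuousMap.tendsto_iff_tendstoLocallyUniformly.1 h1
  have hdiff : ∀ (k : ℕ) (g : Hol Ω), DifferentiableOn ℂ (iteratedDeriv k g.1) Ω := by
    intro k
    induction k with
    | zero => intro g; simpa using g.2.1
    | succ k ih => intro g; rw [iteratedDeriv_succ]; exact (ih g).deriv hΩ
  have h3 : TendstoLocallyUniformlyOn (fun g : Hol Ω => iteratedDeriv k g.1)
      (iteratedDeriv k f.1) (𝓝 f) Ω := by
    induction k with
    | zero => simpa using h2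
    | succ k ih =>
      have := ih.deriv (Eventually.of_forall fun g => hdiff k g) hΩ
      simpa only [iteratedDeriv_succ, Function.comp_def] using this
  exact h3.tendsto_at h0

/-- The restriction of a polynomial to `Ω`. -/
def polyHol (Ω : Set ℂ) (p : ℂ[X]) : Hol Ω :=
  ⟨Ω.indicator fun z => p.eval z,
    p.differentiable.differentiableOn.congr fun z hz => by simp [hz],
    fun z hz => by simp [hz]⟩

lemma tc_polyHol {Ω : Set ℂ} (hΩ : IsOpen Ω) (h0 : (0 : ℂ) ∈ Ω) (p : ℂ[X]) :
    tc (polyHol Ω p).1 = p.coeff := by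
  ext k
  have h1 : (polyHol Ω p).1 =ᶠ[𝓝 0] fun z => p.eval z := by
    filter_upwards [hΩ.mem_nhds h0] with z hz
    simp [polyHol, hz]
  have h2 : ∀ (k : ℕ), iteratedDeriv k (fun z => p.eval z) = fun z => (derivative^[k] p).eval z := by
    intro k
    induction k with
    | zero => simp
    | succ k ih =>
      rw [iteratedDeriv_succ, ih, Function.iterate_succ_apply']
      ext z
      simp
  rw [tc, (h1.iteratedDeriv_eq k), h2]
  simp only
  rw [← Polynomial.coeff_zero_eq_eval_zero,
    Polynomial.coeff_iterate_derivative, zero_add, Nat.descFactorial_self, nsmul_eq_mul,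
    mul_div_cancel_left₀ _ (Nat.cast_ne_zero.2 k.factorial_ne_zero)]

/-- A jointly continuous family of holomorphic functions is continuous. -/
lemma continuous_hol_of_joint {Ω : Set ℂ} {T : Type*} [TopologicalSpace T] (G : T → Hol Ω)
    (h : Continuous fun q : T × Ω => (G q.1).1 q.2) : Continuous G := by
  rw [(Hol.isInducing_toContinuousMap Ω).continuous_iff]
  exact (ContinuousMap.curry ⟨_, h⟩).continuous

lemma dense_range_polyHol {Ω : Set ℂ} (hΩo : IsOpen Ω) (hΩsc : SimplyConnectedSpace Ω) :
    DenseRange (polyHol Ω) := by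
  intro f
  rw [(Hol.isInducing_toContinuousMap Ω).closure_eq_preimage_closure_image, Set.mem_preimage,
    mem_closure_iff_nhds_basis (nhds_basis_uniformity
      (Metric.uniformity_basis_dist.compactConvergenceUniformity))]
  rintro ⟨K, ε⟩ ⟨hK, hε⟩
  obtain ⟨K', hK', hKK', hK'Ω, hc⟩ := exists_compact_connected_compl hΩo hΩsc
    (hK.image continuous_subtype_val) (by rintro _ ⟨z, -, rfl⟩; exact z.2)
  obtain ⟨p, hp⟩ := runge_polynomial hΩo hK' hK'Ω hc f.2.1 hε
  refine ⟨_, ⟨_, ⟨p, rfl⟩, rfl⟩, ?_⟩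
  intro z hz
  have := hp z (hKK' ⟨z, hz, rfl⟩)
  simpa [polyHol, dist_eq_norm, norm_sub_rev] using this

/-- The Hankel matrix of a two-sided sequence attached to a pair `(m, n)`. -/
def hank {R : Type*} [CommRing R] (A : ℤ → R) (m n : ℕ) : Matrix (Fin n) (Fin n) R :=
  Matrix.of fun i j => A ((m : ℤ) - n + 1 + i + j)

/-- The non-constant coefficients of the unnormalized Padé denominator given by Cramer's rule,
in decreasing order of degree. -/
def padeVec {R : Type*} [CommRing R] (A : ℤ → R) (m n : ℕ) : Fin n → R :=
  -((hank A m n).adjugate.mulVec fun i => A ((m : ℤ) + 1 + i))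

/-- The polynomial with constant coefficient `c` and coefficient `x j` in degree `n - j`. -/
def denPoly {n : ℕ} (c : ℂ) (x : Fin n → ℂ) : ℂ[X] :=
  C c + ∑ j : Fin n, C (x j) * X ^ (n - (j : ℕ))

/-- The unnormalized Padé denominator. -/
def padeDen (a : ℕ → ℂ) (m n : ℕ) : ℂ[X] :=
  denPoly (hankelDet a m n) (padeVec (acoefZ a) m n)

/-- The numerator of degree at most `m` associated with a candidate denominator. -/
def numPoly (a : ℕ → ℂ) (m : ℕ) (Q : ℂ[X]) : ℂ[X] :=
  PowerSeries.trunc (m + 1) ((Q : PowerSeries ℂ) * PowerSeries.mk a)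

/-- The unnormalized Padé numerator. -/
def padeNum (a : ℕ → ℂ) (m n : ℕ) : ℂ[X] := numPoly a m (padeDen a m n)

/-- The linearized Padé approximation condition. -/
def PadeApprox (a : ℕ → ℂ) (m n : ℕ) (P Q : ℂ[X]) : Prop :=
  P.natDegree ≤ m ∧ Q.natDegree ≤ n ∧
    (PowerSeries.X : PowerSeries ℂ) ^ (m + n + 1) ∣
      (Q : PowerSeries ℂ) * PowerSeries.mk a - (P : PowerSeries ℂ)

lemma coeff_denPoly {n : ℕ} (c : ℂ) (x : Fin n → ℂ) (k : ℕ) :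
    (denPoly c x).coeff k =
      (if k = 0 then c else 0) + ∑ j : Fin n, if k = n - (j : ℕ) then x j else 0 := by
  simp [denPoly, coeff_C, coeff_X_pow]

lemma coeff_zero_denPoly {n : ℕ} (c : ℂ) (x : Fin n → ℂ) : (denPoly c x).coeff 0 = c := by
  rw [coeff_denPoly, if_pos rfl, Finset.sum_eq_zero, add_zero]
  intro j _
  rw [if_neg]
  have := j.2
  omega

lemma coeff_sub_denPoly {n : ℕ} (c : ℂ) (x : Fin n → ℂ) (i : Fin n) :
    (denPoly c x).coeff (n - (i : ℕ)) = x i := by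
  have hi := i.2
  rw [coeff_denPoly, if_neg (by omega), zero_add, Finset.sum_eq_single i, if_pos rfl]
  · intro j _ hj
    rw [if_neg]
    intro h
    have := j.2
    exact hj (Fin.ext (by omega))
  · simp

lemma natDegree_denPoly_le {n : ℕ} (c : ℂ) (x : Fin n → ℂ) : (denPoly c x).natDegree ≤ n := by
  refine (natDegree_add_le _ _).trans (max_le (by simp) ?_)
  refine natDegree_sum_le_of_forall_le _ _ fun j _ => ?_
  exact (natDegree_C_mul_X_pow_le _ _).trans (Nat.sub_le _ _)

lemma eq_denPoly {n : ℕ} {Q : ℂ[X]} (hQ : Q.natDegree ≤ n) :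
    Q = denPoly (Q.coeff 0) (fun j : Fin n => Q.coeff (n - (j : ℕ))) := by
  ext k
  rcases Nat.eq_zero_or_pos k with rfl | hk
  · rw [coeff_zero_denPoly]
  by_cases hkn : k ≤ n
  · have h := coeff_sub_denPoly (Q.coeff 0) (fun j : Fin n => Q.coeff (n - (j : ℕ)))
      ⟨n - k, by omega⟩
    simp only at h
    rw [show n - (n - k) = k by omega] at h
    rw [h]
  · rw [coeff_eq_zero_of_natDegree_lt (by omega),
      coeff_eq_zero_of_natDegree_lt ((natDegree_denPoly_le _ _).trans_lt (by omega))]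

lemma coeff_C_mul_X_pow_mul_mk (a : ℕ → ℂ) (x : ℂ) (d k : ℕ) :
    PowerSeries.coeff k (((C x * X ^ d : ℂ[X]) : PowerSeries ℂ) * PowerSeries.mk a) =
      x * acoefZ a ((k : ℤ) - d) := by
  rw [Polynomial.coe_mul, Polynomial.coe_C, Polynomial.coe_pow, Polynomial.coe_X, mul_assoc,
    PowerSeries.coeff_C_mul, PowerSeries.coeff_X_pow_mul', acoefZ]
  congr 1
  by_cases h : d ≤ k
  · rw [if_pos h, if_pos (by omega), PowerSeries.coeff_mk]
    congr 1
    omega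
  · rw [if_neg h, if_neg (by omega)]

lemma coeff_denPoly_mul (a : ℕ → ℂ) (m n : ℕ) (c : ℂ) (x : Fin n → ℂ) (i : Fin n) :
    PowerSeries.coeff (m + 1 + (i : ℕ)) ((denPoly c x : PowerSeries ℂ) * PowerSeries.mk a) =
      c * acoefZ a ((m : ℤ) + 1 + i) + ((hank (acoefZ a) m n).mulVec x) i := by
  have h0 := coeff_C_mul_X_pow_mul_mk a c 0 (m + 1 + (i : ℕ))
  rw [pow_zero, mul_one] at h0
  push_cast at h0
  rw [sub_zero] at h0
  have hs : ((denPoly c x : ℂ[X]) : PowerSeries ℂ) = ((C c : ℂ[X]) : PowerSeries ℂ) +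
      ∑ j : Fin n, ((C (x j) * X ^ (n - (j : ℕ)) : ℂ[X]) : PowerSeries ℂ) := by
    rw [denPoly, Polynomial.coe_add]
    congr 1
    simp only [← Polynomial.coeToPowerSeries.ringHom_apply, map_sum]
  rw [hs, add_mul, map_add, Polynomial.coe_C, h0, Finset.sum_mul, map_sum]
  congr 1
  rw [Matrix.mulVec, dotProduct]
  refine Finset.sum_congr rfl fun j _ => ?_
  rw [coeff_C_mul_X_pow_mul_mk, mul_comm]
  congr 1
  rw [hank, Matrix.of_apply]
  congr 1
  have := j.2
  push_cast [Nat.cast_sub this.le]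
  ring

lemma natDegree_numPoly_le (a : ℕ → ℂ) (m : ℕ) (Q : ℂ[X]) : (numPoly a m Q).natDegree ≤ m :=
  Nat.lt_succ_iff.1 (PowerSeries.natDegree_trunc_lt _ _)

lemma PadeApprox.of_coeff_eq_zero {a : ℕ → ℂ} {m n : ℕ} {Q : ℂ[X]} (hQ : Q.natDegree ≤ n)
    (h : ∀ i : Fin n, PowerSeries.coeff (m + 1 + (i : ℕ))
      ((Q : PowerSeries ℂ) * PowerSeries.mk a) = 0) :
    PadeApprox a m n (numPoly a m Q) Q := by
  refine ⟨natDegree_numPoly_le _ _ _, hQ, PowerSeries.X_pow_dvd_iff.2 fun k hk => ?_⟩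
  rw [map_sub, Polynomial.coeff_coe, numPoly, PowerSeries.coeff_trunc]
  split_ifs with hkm
  · exact sub_self _
  · have := h ⟨k - (m + 1), by omega⟩
    simp only at this
    rw [show m + 1 + (k - (m + 1)) = k by omega] at this
    rw [this, sub_zero]

lemma PadeApprox.coeff_eq_zero {a : ℕ → ℂ} {m n : ℕ} {P Q : ℂ[X]} (h : PadeApprox a m n P Q)
    (i : Fin n) :
    PowerSeries.coeff (m + 1 + (i : ℕ)) ((Q : PowerSeries ℂ) * PowerSeries.mk a) = 0 := by
  have hi := i.2
  have h1 := PowerSeries.X_pow_dvd_iff.1 h.2.2 (m + 1 + (i : ℕ)) (by omega)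
  rw [map_sub, Polynomial.coeff_coe,
    coeff_eq_zero_of_natDegree_lt (h.1.trans_lt (by omega)), sub_zero] at h1
  exact h1

lemma PadeApprox.eq_numPoly {a : ℕ → ℂ} {m n : ℕ} {P Q : ℂ[X]} (h : PadeApprox a m n P Q) :
    P = numPoly a m Q := by
  ext k
  rw [numPoly, PowerSeries.coeff_trunc]
  split_ifs with hk
  · have h1 := PowerSeries.X_pow_dvd_iff.1 h.2.2 k (by omega)
    rw [map_sub, Polynomial.coeff_coe, sub_eq_zero] at h1
    exact h1.symm
  · exact coeff_eq_zero_of_natDegree_lt (h.1.trans_lt (by omega))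

lemma isPade_iff {a : ℕ → ℂ} {m n : ℕ} {P Q : ℂ[X]} :
    IsPade a m n P Q ↔ PadeApprox a m n P Q ∧ IsCoprime P Q ∧ Q.coeff 0 = 1 := by
  have h : (∀ j ≤ m + n, (∑ i ∈ Finset.range (j + 1), Q.coeff i * a (j - i)) = P.coeff j) ↔
      (PowerSeries.X : PowerSeries ℂ) ^ (m + n + 1) ∣
        (Q : PowerSeries ℂ) * PowerSeries.mk a - (P : PowerSeries ℂ) := by
    rw [PowerSeries.X_pow_dvd_iff]
    refine forall_congr' fun j => ?_
    rw [Nat.lt_succ_iff, map_sub, sub_eq_zero, Polynomial.coeff_coe, PowerSeries.coeff_mul,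
      Finset.Nat.sum_antidiagonal_eq_sum_range_succ_mk]
    simp only [Polynomial.coeff_coe, PowerSeries.coeff_mk]
  rw [IsPade, PadeApprox, h]
  tauto

lemma PadeApprox.C_mul_sub {a : ℕ → ℂ} {m n : ℕ} {P Q P' Q' : ℂ[X]} (h : PadeApprox a m n P Q)
    (h' : PadeApprox a m n P' Q') (c : ℂ) : PadeApprox a m n (C c * P - P') (C c * Q - Q') := by
  refine ⟨(natDegree_sub_le _ _).trans (max_le ((natDegree_C_mul_le _ _).trans h.1) h'.1),
    (natDegree_sub_le _ _).trans (max_le ((natDegree_C_mul_le _ _).trans h.2.1) h'.2.1), ?_⟩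
  have := dvd_sub (h.2.2.mul_left (PowerSeries.C c)) h'.2.2
  convert this using 1
  simp only [Polynomial.coe_mul, Polynomial.coe_sub, Polynomial.coe_C]
  ring

lemma padeApprox_pade (a : ℕ → ℂ) (m n : ℕ) :
    PadeApprox a m n (padeNum a m n) (padeDen a m n) := by
  refine PadeApprox.of_coeff_eq_zero (natDegree_denPoly_le _ _) fun i => ?_
  have h : (hank (acoefZ a) m n).mulVec (padeVec (acoefZ a) m n) =
      -((hank (acoefZ a) m n).det • fun i : Fin n => acoefZ a ((m : ℤ) + 1 + i)) := by
    rw [padeVec, Matrix.mulVec_neg, Matrix.mulVec_mulVec, Matrix.mul_adjugate, Matrix.smul_mulVec,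
      Matrix.one_mulVec]
  rw [padeDen, coeff_denPoly_mul, h]
  simp only [Pi.neg_apply, Pi.smul_apply, smul_eq_mul]
  exact add_neg_cancel _

/-- If the Hankel determinant does not vanish, a solution of the linearized problem whose
denominator vanishes at the origin is trivial. -/
lemma PadeApprox.eq_zero {a : ℕ → ℂ} {m n : ℕ} {P Q : ℂ[X]} (h : PadeApprox a m n P Q)
    (hd : hankelDet a m n ≠ 0) (hQ : Q.coeff 0 = 0) : P = 0 ∧ Q = 0 := by
  have hQ0 : Q = 0 := by
    have h1 := eq_denPoly h.2.1
    set x : Fin n → ℂ := fun j => Q.coeff (n - (j : ℕ)) with hx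
    have h2 : (hank (acoefZ a) m n).mulVec x = 0 := by
      ext i
      have h3 := h.coeff_eq_zero i
      rw [h1, coeff_denPoly_mul, hQ, zero_mul, zero_add] at h3
      exact h3
    have h4 : x = 0 := Matrix.eq_zero_of_mulVec_eq_zero hd h2
    rw [h1, h4, hQ]
    simp [denPoly]
  refine ⟨?_, hQ0⟩
  rw [h.eq_numPoly, hQ0]
  simp [numPoly]

lemma PadeApprox.mul_eq {a : ℕ → ℂ} {m n : ℕ} {P Q P' Q' : ℂ[X]} (h : PadeApprox a m n P Q)
    (h' : PadeApprox a m n P' Q') : P * Q' = P' * Q := by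
  have h1 := dvd_sub (h'.2.2.mul_left (Q : PowerSeries ℂ)) (h.2.2.mul_left (Q' : PowerSeries ℂ))
  have h2 : (Q : PowerSeries ℂ) * ((Q' : PowerSeries ℂ) * PowerSeries.mk a - (P' : PowerSeries ℂ))
      - (Q' : PowerSeries ℂ) * ((Q : PowerSeries ℂ) * PowerSeries.mk a - (P : PowerSeries ℂ)) =
      ((P * Q' - P' * Q : ℂ[X]) : PowerSeries ℂ) := by
    simp only [Polynomial.coe_sub, Polynomial.coe_mul]
    ring
  rw [h2, PowerSeries.X_pow_dvd_iff] at h1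
  rw [← sub_eq_zero]
  ext k
  rw [coeff_zero]
  by_cases hk : k < m + n + 1
  · rw [← Polynomial.coeff_coe]; exact h1 k hk
  · refine coeff_eq_zero_of_natDegree_lt (lt_of_le_of_lt ?_ (not_lt.1 hk))
    exact (natDegree_sub_le _ _).trans (max_le (natDegree_mul_le_of_le h.1 h'.2.1)
      (natDegree_mul_le_of_le h'.1 h.2.1))

/-- A Padé approximant whose numerator has full degree forces the Hankel determinant to be
nonzero. -/
lemma hankelDet_ne_zero_of_natDegree {a : ℕ → ℂ} {m n : ℕ} {P Q : ℂ[X]} (h : IsPade a m n P Q)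
    (hP : P.natDegree = m) (hP0 : P ≠ 0) : hankelDet a m n ≠ 0 := by
  intro hd
  obtain ⟨h, hc, hQ⟩ := isPade_iff.1 h
  obtain ⟨x, hx0, hx⟩ := Matrix.exists_mulVec_eq_zero_iff.2 hd
  have hA : PadeApprox a m n (numPoly a m (denPoly 0 x)) (denPoly 0 x) := by
    refine PadeApprox.of_coeff_eq_zero (natDegree_denPoly_le _ _) fun i => ?_
    rw [coeff_denPoly_mul, zero_mul, zero_add]
    exact congrFun hx i
  have hmul := h.mul_eq hA
  obtain ⟨R, hR⟩ : Q ∣ denPoly 0 x := by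
    refine hc.symm.dvd_of_dvd_mul_left ?_
    rw [hmul]
    exact dvd_mul_left _ _
  have hQ0 : Q ≠ 0 := by rintro rfl; simp at hQ
  have hPR : numPoly a m (denPoly 0 x) = P * R := by
    rw [hR] at hmul ⊢
    refine mul_right_cancel₀ hQ0 ?_
    rw [← hmul]; ring
  have hRdeg : R.natDegree = 0 := by
    by_cases hR0 : R = 0
    · simp [hR0]
    have h1 := hA.1
    rw [hPR, natDegree_mul hP0 hR0, hP] at h1
    omega
  have h2 := coeff_zero_denPoly (0 : ℂ) x
  rw [hR, mul_coeff_zero, hQ, one_mul] at h2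
  have hR0 : R = 0 := by rw [eq_C_of_natDegree_eq_zero hRdeg, h2, C_0]
  refine hx0 (funext fun i => ?_)
  rw [← coeff_sub_denPoly 0 x i, hR, hR0]
  simp

/-- When the Hankel determinant does not vanish, the Padé approximant exists and is given by
Cramer's rule. -/
lemma isPade_iff_eq {a : ℕ → ℂ} {m n : ℕ} (hd : hankelDet a m n ≠ 0) {P Q : ℂ[X]} :
    IsPade a m n P Q ↔
      C (hankelDet a m n) * P = padeNum a m n ∧ C (hankelDet a m n) * Q = padeDen a m n := by
  constructor
  · intro h
    obtain ⟨h, -, hQ⟩ := isPade_iff.1 h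
    have h1 := (h.C_mul_sub (padeApprox_pade a m n) (hankelDet a m n)).eq_zero hd (by
      rw [coeff_sub, coeff_C_mul, hQ, padeDen, coeff_zero_denPoly, mul_one, sub_self])
    exact ⟨sub_eq_zero.1 h1.1, sub_eq_zero.1 h1.2⟩
  · rintro ⟨hP, hQ⟩
    have hcoe : ∀ p q : ℂ[X], C (hankelDet a m n) * p = q → p = C (hankelDet a m n)⁻¹ * q := by
      rintro p q rfl
      rw [← mul_assoc, ← C_mul, inv_mul_cancel₀ hd, C_1, one_mul]
    have hA : PadeApprox a m n P Q := by
      have h0 : PadeApprox a m n 0 0 := ⟨by simp, by simp, by simp⟩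
      have := (padeApprox_pade a m n).C_mul_sub h0 (hankelDet a m n)⁻¹
      rwa [sub_zero, sub_zero, ← hcoe _ _ hP, ← hcoe _ _ hQ] at this
    have hQ1 : Q.coeff 0 = 1 := by
      rw [hcoe _ _ hQ, coeff_C_mul, padeDen, coeff_zero_denPoly, inv_mul_cancel₀ hd]
    refine isPade_iff.2 ⟨hA, ?_, hQ1⟩
    have hQ0 : Q ≠ 0 := by rintro rfl; simp at hQ1
    rw [← EuclideanDomain.gcd_isUnit_iff]
    set d := EuclideanDomain.gcd P Q with hdd
    obtain ⟨P', hP'⟩ := EuclideanDomain.gcd_dvd_left P Q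
    obtain ⟨Q', hQ'⟩ := EuclideanDomain.gcd_dvd_right P Q
    rw [← hdd] at hP' hQ'
    by_contra hu
    have hd0 : d ≠ 0 := by rintro h0; rw [h0, zero_mul] at hQ'; exact hQ0 hQ'
    have hdeg : 1 ≤ d.natDegree := by
      by_contra hlt
      have h0 : d.natDegree = 0 := by omega
      rw [eq_C_of_natDegree_eq_zero h0] at hd0 hu
      exact hu (isUnit_C.2 (isUnit_iff_ne_zero.2 fun h => hd0 (by rw [h, C_0])))
    have hdc : d.coeff 0 ≠ 0 := by
      intro h0
      rw [hQ', mul_coeff_zero, h0, zero_mul] at hQ1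
      exact zero_ne_one hQ1
    have hle : ∀ {p q : ℂ[X]} {N : ℕ}, p = d * q → p.natDegree ≤ N → (X * q).natDegree ≤ N := by
      intro p q N hpq hN
      by_cases hq : q = 0
      · simp [hq]
      · rw [natDegree_X_mul hq]
        rw [hpq, natDegree_mul hd0 hq] at hN
        omega
    have hXA : PadeApprox a m n (X * P') (X * Q') := by
      refine ⟨hle hP' hA.1, hle hQ' hA.2.1, ?_⟩
      have h1 := hA.2.2
      have hunit : IsUnit (d : PowerSeries ℂ) := by
        rw [PowerSeries.isUnit_iff_constantCoeff, ← PowerSeries.coeff_zero_eq_constantCoeff_apply,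
          Polynomial.coeff_coe]
        exact isUnit_iff_ne_zero.2 hdc
      rw [hP', hQ', Polynomial.coe_mul, Polynomial.coe_mul, mul_assoc, ← mul_sub,
        hunit.dvd_mul_left] at h1
      rw [Polynomial.coe_mul, Polynomial.coe_mul, mul_assoc, ← mul_sub]
      exact h1.mul_left _
    have h2 := (hXA.eq_zero hd (by simp)).2
    rcases mul_eq_zero.1 h2 with h3 | h3
    · exact X_ne_zero h3
    · rw [h3, mul_zero] at hQ'
      exact hQ0 hQ'

lemma exists_isPade {a : ℕ → ℂ} {m n : ℕ} (hd : hankelDet a m n ≠ 0) :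
    ∃ P Q : ℂ[X], IsPade a m n P Q := by
  refine ⟨C (hankelDet a m n)⁻¹ * padeNum a m n, C (hankelDet a m n)⁻¹ * padeDen a m n,
    (isPade_iff_eq hd).2 ⟨?_, ?_⟩⟩ <;>
  rw [← mul_assoc, ← C_mul, mul_inv_cancel₀ hd, C_1, one_mul]

lemma mem_Nset_iff {a : ℕ → ℂ} {m n : ℕ} (hn : 0 < n) :
    a ∈ Nset m n ↔ hankelDet a m n * padeVec (acoefZ a) m n ⟨0, hn⟩ ≠ 0 := by
  have hco : (padeDen a m n).coeff n = padeVec (acoefZ a) m n ⟨0, hn⟩ := by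
    simpa [padeDen] using
      coeff_sub_denPoly (hankelDet a m n) (padeVec (acoefZ a) m n) ⟨0, hn⟩
  rw [mul_ne_zero_iff, ← hco]
  refine and_congr_right fun hd => ?_
  constructor
  · rintro ⟨P, Q, h, hdeg⟩
    rw [← ((isPade_iff_eq hd).1 h).2, coeff_C_mul]
    exact mul_ne_zero hd (coeff_ne_zero_of_eq_degree hdeg)
  · intro hne
    obtain ⟨P, Q, h⟩ := exists_isPade hd
    refine ⟨P, Q, h, le_antisymm (natDegree_le_iff_degree_le.1 h.2.1) (le_degree_of_ne_zero ?_)⟩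
    rw [← ((isPade_iff_eq hd).1 h).2, coeff_C_mul] at hne
    exact right_ne_zero_of_mul hne

lemma padePoles_eq {a : ℕ → ℂ} {m n : ℕ → ℕ} (h : ∀ k, a ∈ Nset (m k) (n k)) :
    padePoles a m n Set.univ = {z | ∃ k, (padeDen a (m k) (n k)).eval z = 0} := by
  ext z
  constructor
  · rintro ⟨k, -, P, Q, hP, hz⟩
    refine ⟨k, ?_⟩
    rw [← ((isPade_iff_eq (h k).1).1 hP).2, eval_mul, hz, mul_zero]
  · rintro ⟨k, hz⟩
    obtain ⟨P, Q, hP⟩ := exists_isPade (h k).1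
    refine ⟨k, trivial, P, Q, hP, ?_⟩
    rw [← ((isPade_iff_eq (h k).1).1 hP).2, eval_mul, eval_C] at hz
    exact (mul_eq_zero.1 hz).resolve_left (h k).1

lemma padeZeros_eq {a : ℕ → ℂ} {m n : ℕ → ℕ} (h : ∀ k, a ∈ Nset (m k) (n k)) :
    padeZeros a m n Set.univ = {z | ∃ k, (padeNum a (m k) (n k)).eval z = 0} := by
  ext z
  constructor
  · rintro ⟨k, -, P, Q, hP, hz⟩
    refine ⟨k, ?_⟩
    rw [← ((isPade_iff_eq (h k).1).1 hP).1, eval_mul, hz, mul_zero]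
  · rintro ⟨k, hz⟩
    obtain ⟨P, Q, hP⟩ := exists_isPade (h k).1
    refine ⟨k, trivial, P, Q, hP, ?_⟩
    rw [← ((isPade_iff_eq (h k).1).1 hP).1, eval_mul, eval_C] at hz
    exact (mul_eq_zero.1 hz).resolve_left (h k).1

/-- If all roots of a polynomial are at distance at least `ρ` from `w`, its value at `w` cannot be
much smaller than its value at another point. -/
lemma norm_eval_le_of_forall_root {ρ : ℝ} (hρ : 0 < ρ) (w z : ℂ) (N : ℕ) (P : ℂ[X])
    (hP : P.natDegree ≤ N) (h : ∀ r, P.eval r = 0 → ρ ≤ ‖w - r‖) :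
    ‖P.eval z‖ ≤ (1 + ‖z - w‖ / ρ) ^ N * ‖P.eval w‖ := by
  have hK : 1 ≤ 1 + ‖z - w‖ / ρ := le_add_of_nonneg_right (by positivity)
  induction N generalizing P with
  | zero =>
    rw [eq_C_of_natDegree_eq_zero (Nat.le_zero.1 hP)]
    simp
  | succ N ih =>
    by_cases hd : P.natDegree ≤ N
    · refine (ih P hd h).trans ?_
      gcongr ?_ * _
      exact pow_le_pow_right₀ hK N.le_succ
    · have hdeg : P.degree ≠ 0 := by
        intro h0
        rw [natDegree_eq_zero_iff_degree_le_zero.2 h0.le] at hd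
        exact hd N.zero_le
      obtain ⟨r, hr⟩ := IsAlgClosed.exists_root P hdeg
      obtain ⟨Q, rfl⟩ := dvd_iff_isRoot.2 hr
      have hQ0 : Q ≠ 0 := by
        rintro rfl
        simp at hd
      have hQ : Q.natDegree ≤ N := by
        rw [natDegree_mul (X_sub_C_ne_zero r) hQ0, natDegree_X_sub_C] at hP
        omega
      have h1 := ih Q hQ fun s hs => h s (by rw [eval_mul, hs, mul_zero])
      have h2 : ρ ≤ ‖w - r‖ := h r hr
      have h3 : ‖z - r‖ ≤ (1 + ‖z - w‖ / ρ) * ‖w - r‖ := by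
        have h4 : ‖z - w‖ ≤ ‖z - w‖ / ρ * ‖w - r‖ := by
          rw [div_mul_eq_mul_div, le_div_iff₀ hρ]
          gcongr
        have h5 := norm_add_le (z - w) (w - r)
        rw [sub_add_sub_cancel] at h5
        linarith
      simp only [eval_mul, eval_sub, eval_X, eval_C, norm_mul]
      calc ‖z - r‖ * ‖Q.eval z‖
          ≤ ((1 + ‖z - w‖ / ρ) * ‖w - r‖) * ((1 + ‖z - w‖ / ρ) ^ N * ‖Q.eval w‖) := by
            gcongr
        _ = _ := by ring

/-- Having a root in an open set is an open condition on nonzero polynomials of bounded degree. -/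
lemma isOpen_setOf_exists_root {T : Type*} [TopologicalSpace T] (p : T → ℂ[X]) (N : ℕ)
    (hN : ∀ t, (p t).natDegree ≤ N) (hp : ∀ z, Continuous fun t => (p t).eval z)
    {V : Set ℂ} (hV : IsOpen V) : IsOpen {t | p t ≠ 0 ∧ ∃ w ∈ V, (p t).eval w = 0} := by
  rw [isOpen_iff_mem_nhds]
  rintro t ⟨ht, w, hw, hwt⟩
  obtain ⟨z, hz⟩ : ∃ z, (p t).eval z ≠ 0 := by
    by_contra! hcon
    exact ht (Polynomial.funext fun z => by rw [hcon z, eval_zero])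
  obtain ⟨ρ, hρ, hball⟩ := Metric.isOpen_iff.1 hV w hw
  have hopen : IsOpen {s | (1 + ‖z - w‖ / ρ) ^ N * ‖(p s).eval w‖ < ‖(p s).eval z‖} :=
    isOpen_lt ((hp w).norm.const_mul _) (hp z).norm
  refine mem_of_superset (hopen.mem_nhds ?_) fun s hs => ?_
  · change (1 + ‖z - w‖ / ρ) ^ N * ‖(p t).eval w‖ < ‖(p t).eval z‖
    rw [hwt, norm_zero, mul_zero]
    exact norm_pos_iff.2 hz
  · change (1 + ‖z - w‖ / ρ) ^ N * ‖(p s).eval w‖ < ‖(p s).eval z‖ at hs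
    refine ⟨?_, ?_⟩
    · intro h0
      rw [h0] at hs
      simp at hs
    · by_contra! hcon
      refine hs.not_ge (norm_eval_le_of_forall_root hρ w z N (p s) (hN s) fun r hr => ?_)
      by_contra! hlt
      refine hcon r (hball ?_) hr
      rwa [Metric.mem_ball, dist_comm, dist_eq_norm]

lemma continuous_acoefZ (k : ℤ) : Continuous fun a : ℕ → ℂ => acoefZ a k := by
  unfold acoefZ
  split_ifs
  · exact continuous_apply _
  · exact continuous_const

lemma continuous_hank (m n : ℕ) : Continuous fun a : ℕ → ℂ => hank (acoefZ a) m n :=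
  continuous_matrix fun _ _ => continuous_acoefZ _

lemma continuous_hankelDet (m n : ℕ) : Continuous fun a : ℕ → ℂ => hankelDet a m n :=
  (continuous_hank m n).matrix_det

lemma continuous_padeVec (m n : ℕ) : Continuous fun a : ℕ → ℂ => padeVec (acoefZ a) m n :=
  ((continuous_hank m n).matrix_adjugate.matrix_mulVec
    (continuous_pi fun _ => continuous_acoefZ _)).neg

lemma continuous_coeff_padeDen (m n k : ℕ) :
    Continuous fun a : ℕ → ℂ => (padeDen a m n).coeff k := by
  simp only [padeDen, coeff_denPoly]
  refine Continuous.add ?_ (continuous_finsetSum _ fun j _ => ?_)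
  · split_ifs
    · exact continuous_hankelDet m n
    · exact continuous_const
  · split_ifs
    · exact (continuous_apply j).comp (continuous_padeVec m n)
    · exact continuous_const

lemma continuous_coeff_padeNum (m n k : ℕ) :
    Continuous fun a : ℕ → ℂ => (padeNum a m n).coeff k := by
  simp only [padeNum, numPoly, PowerSeries.coeff_trunc, PowerSeries.coeff_mul,
    Polynomial.coeff_coe, PowerSeries.coeff_mk]
  split_ifs
  · exact continuous_finsetSum _ fun x _ =>
      (continuous_coeff_padeDen m n x.1).mul (continuous_apply _)
  · exact continuous_const

lemma continuous_eval_of_coeff {T : Type*} [TopologicalSpace T] {p : T → ℂ[X]} {N : ℕ}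
    (hN : ∀ t, (p t).natDegree ≤ N) (h : ∀ k, Continuous fun t => (p t).coeff k) (z : ℂ) :
    Continuous fun t => (p t).eval z := by
  have : (fun t => (p t).eval z) = fun t => ∑ k ∈ Finset.range (N + 1), (p t).coeff k * z ^ k := by
    funext t
    exact eval_eq_sum_range' (Nat.lt_succ_of_le (hN t)) z
  rw [this]
  exact continuous_finsetSum _ fun k _ => (h k).mul continuous_const

lemma isOpen_Nset {m n : ℕ} (hn : 0 < n) : IsOpen (Nset m n) := by
  have : Nset m n = {a | hankelDet a m n * padeVec (acoefZ a) m n ⟨0, hn⟩ ≠ 0} :=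
    Set.ext fun a => mem_Nset_iff hn
  rw [this]
  exact isOpen_ne_fun ((continuous_hankelDet m n).mul
    ((continuous_apply _).comp (continuous_padeVec m n))) continuous_const

lemma map_det_mul_padeVec {R S : Type*} [CommRing R] [CommRing S] (φ : R →+* S) (A : ℤ → R)
    (m n : ℕ) (i : Fin n) :
    φ ((hank A m n).det * padeVec A m n i) =
      (hank (fun k => φ (A k)) m n).det * padeVec (fun k => φ (A k)) m n i := by
  have h1 : φ.mapMatrix (hank A m n) = hank (fun k => φ (A k)) m n := rfl
  rw [map_mul, RingHom.map_det, h1]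
  congr 1
  rw [padeVec, padeVec, ← h1, ← RingHom.map_adjugate]
  simp only [Pi.neg_apply, map_neg, RingHom.map_mulVec]
  rfl

/-- On a line through an element of `𝒩_{m,n}`, membership in `𝒩_{m,n}` fails only at the roots of
a nonzero polynomial. -/
lemma exists_poly_line_mem_Nset {m n : ℕ} (hn : 0 < n) (a b : ℕ → ℂ) (hb : b ∈ Nset m n) :
    ∃ Φ : ℂ[X], Φ ≠ 0 ∧ ∀ t, Φ.eval t ≠ 0 → (fun k => a k + t * (b k - a k)) ∈ Nset m n := by
  set A : ℤ → ℂ[X] := fun k => C (acoefZ a k) + X * C (acoefZ b k - acoefZ a k) with hA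
  have hev : ∀ t : ℂ, ((hank A m n).det * padeVec A m n ⟨0, hn⟩).eval t =
      hankelDet (fun k => a k + t * (b k - a k)) m n *
        padeVec (acoefZ fun k => a k + t * (b k - a k)) m n ⟨0, hn⟩ := by
    intro t
    have h1 := map_det_mul_padeVec (evalRingHom t) A m n ⟨0, hn⟩
    have h2 : (fun k => evalRingHom t (A k)) = acoefZ fun k => a k + t * (b k - a k) := by
      funext k
      simp only [hA, coe_evalRingHom, eval_add, eval_mul, eval_C, eval_X, acoefZ]
      split_ifs <;> simp
    rw [h2] at h1
    exact h1
  refine ⟨(hank A m n).det * padeVec A m n ⟨0, hn⟩, ?_, fun t ht => ?_⟩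
  · intro h0
    have h1 := hev 1
    rw [h0, eval_zero] at h1
    refine (mem_Nset_iff hn).1 hb ?_
    rw [h1]
    simp
  · rw [mem_Nset_iff hn, ← hev]
    exact ht

lemma mk_coeff (s : ℂ[X]) : PowerSeries.mk s.coeff = (s : PowerSeries ℂ) := by
  ext k
  simp

lemma isPade_of_mul_sub {s P Q : ℂ[X]} {m n : ℕ} (hP : P.natDegree ≤ m) (hQ : Q.natDegree ≤ n)
    (hc : IsCoprime P Q) (hQ0 : Q.coeff 0 = 1) (h : X ^ (m + n + 1) ∣ Q * s - P) :
    IsPade s.coeff m n P Q := by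
  refine isPade_iff.2 ⟨⟨hP, hQ, ?_⟩, hc, hQ0⟩
  obtain ⟨r, hr⟩ := h
  refine ⟨(r : PowerSeries ℂ), ?_⟩
  rw [mk_coeff, ← Polynomial.coe_mul, ← Polynomial.coe_sub, hr, Polynomial.coe_mul,
    Polynomial.coe_pow, Polynomial.coe_X]

lemma coeff_X_pow_add_X_pow_mem_Nset {m n : ℕ} (hn : 0 < n) :
    (X ^ m + X ^ (m + n) : ℂ[X]).coeff ∈ Nset m n := by
  have hdeg : (1 - X ^ n : ℂ[X]).degree = n := by
    rw [← neg_sub, degree_neg, ← C_1, degree_X_pow_sub_C hn]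
  have hP : IsPade (X ^ m + X ^ (m + n) : ℂ[X]).coeff m n (X ^ m) (1 - X ^ n) := by
    refine isPade_of_mul_sub (by simp) (natDegree_le_of_degree_le hdeg.le) ?_ ?_ ?_
    · refine IsCoprime.pow_left ⟨X ^ (n - 1), 1, ?_⟩
      rw [← pow_succ, Nat.sub_add_cancel hn]
      ring
    · simp [hn.ne]
    · refine ⟨-X ^ (n - 1), ?_⟩
      obtain ⟨l, rfl⟩ : ∃ l, n = l + 1 := ⟨n - 1, by omega⟩
      simp only [Nat.add_sub_cancel]
      ring
  exact ⟨hankelDet_ne_zero_of_natDegree hP (by simp) (by simp), _, _, hP, hdeg⟩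

/-- A perturbation of a polynomial by a truncated geometric series. -/
def geomPerturb (p : ℂ[X]) (m n : ℕ) (δ u : ℂ) : ℂ[X] :=
  p + C δ * X ^ m * ∑ i ∈ Finset.range (n + 1), (C u * X) ^ i

lemma isPade_geomPerturb {p : ℂ[X]} {m n : ℕ} (hp : p.natDegree + 1 < m) (hn : 0 < n) {δ : ℂ}
    (hδ : δ ≠ 0) (u : ℂ) :
    hankelDet (geomPerturb p m n δ u).coeff m n ≠ 0 ∧
      IsPade (geomPerturb p m n δ u).coeff m n (p * (1 - C u * X) + C δ * X ^ m)
        (1 - C u * X) ∧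
      p * (1 - C u * X) + C δ * X ^ m ≠ 0 := by
  have hQ : (1 - C u * X : ℂ[X]).natDegree ≤ 1 :=
    (natDegree_sub_le _ _).trans (max_le (by simp) (natDegree_C_mul_le _ _ |>.trans natDegree_X_le))
  have hlt : (p * (1 - C u * X)).natDegree < (C δ * X ^ m).natDegree := by
    rw [natDegree_C_mul_X_pow m δ hδ]
    exact (natDegree_mul_le_of_le le_rfl hQ).trans_lt hp
  have hdeg : (p * (1 - C u * X) + C δ * X ^ m).natDegree = m := by
    rw [natDegree_add_eq_right_of_natDegree_lt hlt, natDegree_C_mul_X_pow m δ hδ]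
  have hP : IsPade (geomPerturb p m n δ u).coeff m n (p * (1 - C u * X) + C δ * X ^ m)
      (1 - C u * X) := by
    refine isPade_of_mul_sub hdeg.le (hQ.trans hn) ?_ (by simp) ?_
    · have h1 : IsCoprime (X : ℂ[X]) (1 - C u * X) := ⟨C u, 1, by ring⟩
      have h2 : IsCoprime (C δ * X ^ m) (1 - C u * X) :=
        (isCoprime_mul_unit_left_left (isUnit_C.2 hδ.isUnit) _ _).2 h1.pow_left
      have h3 := h2.add_mul_right_left p
      rwa [add_comm] at h3
    · refine ⟨-(C δ * C u ^ (n + 1)), ?_⟩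
      have h1 := mul_neg_geom_sum (C u * X : ℂ[X]) (n + 1)
      rw [geomPerturb]
      linear_combination (C δ * X ^ m) * h1
  have hne : p * (1 - C u * X) + C δ * X ^ m ≠ 0 := by
    intro h0
    rw [h0, natDegree_zero] at hdeg
    omega
  exact ⟨hankelDet_ne_zero_of_natDegree hP hdeg hne, hP, hne⟩

lemma continuous_polyHol (Ω : Set ℂ) {T : Type*} [TopologicalSpace T] (G : T → ℂ[X])
    (h : Continuous fun q : T × ℂ => (G q.1).eval q.2) :
    Continuous fun t => polyHol Ω (G t) := by
  refine continuous_hol_of_joint _ ?_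
  have : (fun q : T × Ω => (polyHol Ω (G q.1)).1 q.2) =
      fun q : T × Ω => (G q.1).eval (q.2 : ℂ) := by
    funext q
    simp [polyHol]
  rw [this]
  exact h.comp (continuous_fst.prodMk (continuous_subtype_val.comp continuous_snd))

lemma dense_preimage_Nset {Ω : Set ℂ} (hΩo : IsOpen Ω) (h0 : (0 : ℂ) ∈ Ω)
    (hΩsc : SimplyConnectedSpace Ω) {m n : ℕ} (hn : 0 < n) :
    Dense {f : Hol Ω | tc f.1 ∈ Nset m n} := by
  rw [dense_iff_inter_open]
  intro O hO hOne
  obtain ⟨p, hp⟩ := (dense_range_polyHol hΩo hΩsc).exists_mem_open hO hOne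
  obtain ⟨Φ, hΦ, hmem⟩ := exists_poly_line_mem_Nset hn p.coeff _
    (coeff_X_pow_add_X_pow_mem_Nset (m := m) hn)
  set q : ℂ[X] := X ^ m + X ^ (m + n)
  have hG : Continuous fun t : ℂ => polyHol Ω (p + C t * (q - p)) := by
    refine continuous_polyHol Ω _ ?_
    simp only [eval_add, eval_mul, eval_C]
    exact (p.continuous.comp continuous_snd).add
      (continuous_fst.mul ((q - p).continuous.comp continuous_snd))
  have hd : Dense ({t | Φ.IsRoot t}ᶜ) :=
    (Polynomial.finite_setOfPred_isRoot hΦ).countable.dense_compl ℂ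
  obtain ⟨t, ht, htO⟩ := hd.exists_mem_open (hO.preimage hG) ⟨0, by simpa using hp⟩
  refine ⟨_, htO, ?_⟩
  change tc (polyHol Ω (p + C t * (q - p))).1 ∈ Nset m n
  rw [tc_polyHol hΩo h0]
  convert hmem t ht using 1
  ext k
  simp

lemma continuous_eval_geomPerturb {T : Type*} [TopologicalSpace T] (p : ℂ[X]) (m n : ℕ)
    {δ u : T → ℂ} (hδ : Continuous δ) (hu : Continuous u) :
    Continuous fun q : T × ℂ => (geomPerturb p m n (δ q.1) (u q.1)).eval q.2 := by
  simp only [geomPerturb, eval_add, eval_mul, eval_C, eval_pow, eval_X, eval_finsetSum]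
  have h1 := p.continuous
  fun_prop

lemma exists_geomPerturb_mem {Ω : Set ℂ} {O : Set (Hol Ω)} (hO : IsOpen O) {p : ℂ[X]}
    (hp : polyHol Ω p ∈ O) (m n : ℕ) {u : ℂ → ℂ} (hu : Continuous u) :
    ∃ δ, δ ≠ 0 ∧ polyHol Ω (geomPerturb p m n δ (u δ)) ∈ O := by
  have hG : Continuous fun δ : ℂ => polyHol Ω (geomPerturb p m n δ (u δ)) :=
    continuous_polyHol Ω _
      (continuous_eval_geomPerturb (δ := fun δ => δ) p m n continuous_id hu)
  have h0 : polyHol Ω (geomPerturb p m n 0 (u 0)) ∈ O := by simpa [geomPerturb] using hp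
  obtain ⟨δ, hδ, hδO⟩ := (dense_compl_singleton (0 : ℂ)).exists_mem_open (hO.preimage hG)
    (Set.nonempty_of_mem (x := 0) h0)
  exact ⟨δ, hδ, hδO⟩

lemma padeDen_ne_zero {a : ℕ → ℂ} {m n : ℕ} (hd : hankelDet a m n ≠ 0) :
    padeDen a m n ≠ 0 := by
  intro h0
  refine hd ?_
  rw [← coeff_zero_denPoly (hankelDet a m n) (padeVec (acoefZ a) m n)]
  exact (congrArg (fun r : ℂ[X] => r.coeff 0) h0).trans (coeff_zero 0)

/-- Near every holomorphic function there is one having a Padé approximant with a pole in a given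
nonempty open set. -/
lemma exists_padeDen_root {Ω : Set ℂ} (hΩo : IsOpen Ω) (h0 : (0 : ℂ) ∈ Ω)
    (hΩsc : SimplyConnectedSpace Ω) {m n : ℕ → ℕ} (hn : ∀ k, 0 < n k)
    (hub : ∀ N : ℕ, ∃ k, N < m k) {V : Set ℂ} (hV : IsOpen V) (hVne : V.Nonempty)
    {O : Set (Hol Ω)} (hO : IsOpen O) (hOne : O.Nonempty) :
    ∃ f ∈ O, ∃ k, padeDen (tc f.1) (m k) (n k) ≠ 0 ∧
      ∃ w ∈ V, (padeDen (tc f.1) (m k) (n k)).eval w = 0 := by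
  obtain ⟨p, hp⟩ := (dense_range_polyHol hΩo hΩsc).exists_mem_open hO hOne
  obtain ⟨w, hw0, hw⟩ := (dense_compl_singleton (0 : ℂ)).exists_mem_open hV hVne
  obtain ⟨k, hk⟩ := hub (p.natDegree + 1)
  obtain ⟨δ, hδ, hδO⟩ := exists_geomPerturb_mem hO hp (m k) (n k)
    (continuous_const (y := w⁻¹))
  obtain ⟨hd, hP, -⟩ := isPade_geomPerturb hk (hn k) hδ w⁻¹
  refine ⟨_, hδO, k, ?_⟩
  rw [tc_polyHol hΩo h0]
  have h1 := ((isPade_iff_eq hd).1 hP).2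
  refine ⟨padeDen_ne_zero hd, w, hw, ?_⟩
  have hw0' : w ≠ 0 := hw0
  rw [← h1]
  simp [hw0']

lemma padeNum_ne_zero_of_mem_Nset {a : ℕ → ℂ} {m n : ℕ} (hn : 0 < n) (h : a ∈ Nset m n) :
    padeNum a m n ≠ 0 := by
  obtain ⟨hd, P, Q, hP, hdeg⟩ := h
  intro h0
  have h1 := ((isPade_iff_eq hd).1 hP).1
  rw [h0] at h1
  have hP0 : P = 0 := (mul_eq_zero.1 h1).resolve_left (C_ne_zero.2 hd)
  have hu : IsUnit Q := by
    have := hP.2.2.1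
    rwa [hP0, isCoprime_zero_left] at this
  rw [degree_eq_zero_of_isUnit hu] at hdeg
  have : 0 = n := by exact_mod_cast hdeg
  omega

/-- Near every holomorphic function there is one having a Padé approximant with a zero in a given
nonempty open set. -/
lemma exists_padeNum_root {Ω : Set ℂ} (hΩo : IsOpen Ω) (h0 : (0 : ℂ) ∈ Ω)
    (hΩsc : SimplyConnectedSpace Ω) {m n : ℕ → ℕ} (hn : ∀ k, 0 < n k)
    (hub : ∀ N : ℕ, ∃ k, N < m k) {V : Set ℂ} (hV : IsOpen V) (hVne : V.Nonempty)
    {O : Set (Hol Ω)} (hO : IsOpen O) (hOne : O.Nonempty) :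
    ∃ f ∈ O, ∃ k, padeNum (tc f.1) (m k) (n k) ≠ 0 ∧
      ∃ w ∈ V, (padeNum (tc f.1) (m k) (n k)).eval w = 0 := by
  obtain ⟨p', hp'⟩ := (dense_range_polyHol hΩo hΩsc).exists_mem_open hO hOne
  obtain ⟨w, hw0, hw⟩ := (dense_compl_singleton (0 : ℂ)).exists_mem_open hV hVne
  have hw0' : w ≠ 0 := hw0
  obtain ⟨p, hp, hpw⟩ : ∃ p : ℂ[X], polyHol Ω p ∈ O ∧ p.eval w ≠ 0 := by
    have hG : Continuous fun c : ℂ => polyHol Ω (p' + C c) := by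
      refine continuous_polyHol Ω _ ?_
      simp only [eval_add, eval_C]
      exact (p'.continuous.comp continuous_snd).add continuous_fst
    obtain ⟨c, hc, hcO⟩ := (dense_compl_singleton (-p'.eval w)).exists_mem_open
      (hO.preimage hG) ⟨0, by simpa using hp'⟩
    refine ⟨_, hcO, fun h => hc ?_⟩
    rw [eval_add, eval_C] at h
    exact eq_neg_of_add_eq_zero_right h
  obtain ⟨k, hk⟩ := hub (p.natDegree + 1)
  obtain ⟨δ, hδ, hδO⟩ := exists_geomPerturb_mem hO hp (m k) (n k)
    (show Continuous fun δ : ℂ => (1 + δ * w ^ m k / p.eval w) / w by fun_prop)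
  obtain ⟨hd, hP, hne⟩ := isPade_geomPerturb hk (hn k) hδ ((1 + δ * w ^ m k / p.eval w) / w)
  refine ⟨_, hδO, k, ?_⟩
  rw [tc_polyHol hΩo h0]
  have h1 := ((isPade_iff_eq hd).1 hP).1
  have hroot : (p * (1 - C ((1 + δ * w ^ m k / p.eval w) / w) * X) + C δ * X ^ m k).eval w = 0 := by
    simp only [eval_add, eval_mul, eval_sub, eval_one, eval_C, eval_X, eval_pow]
    field_simp
    ring
  rw [← h1]
  refine ⟨mul_ne_zero (C_ne_zero.2 hd) hne, w, hw, ?_⟩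
  rw [eval_mul, hroot, mul_zero]

/-- Genericity of functions whose Padé approximants have a dense set of poles or zeros. -/
lemma isGδ_and_dense_of_roots {Ω : Set ℂ} (hΩo : IsOpen Ω) (h0 : (0 : ℂ) ∈ Ω)
    (hΩsc : SimplyConnectedSpace Ω) {m n : ℕ → ℕ} (hn : ∀ k, 0 < n k)
    (D : ℕ → (ℕ → ℂ) → ℂ[X]) (N : ℕ → ℕ) (hN : ∀ k a, (D k a).natDegree ≤ N k)
    (hD : ∀ k j, Continuous fun a => (D k a).coeff j)
    (hD0 : ∀ k a, a ∈ Nset (m k) (n k) → D k a ≠ 0)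
    (hroot : ∀ V : Set ℂ, IsOpen V → V.Nonempty → ∀ O : Set (Hol Ω), IsOpen O → O.Nonempty →
      ∃ f ∈ O, ∃ k, D k (tc f.1) ≠ 0 ∧ ∃ w ∈ V, (D k (tc f.1)).eval w = 0) :
    IsGδ {f : Hol Ω | (∀ k, tc f.1 ∈ Nset (m k) (n k)) ∧
        Dense {z | ∃ k, (D k (tc f.1)).eval z = 0}} ∧
      Dense {f : Hol Ω | (∀ k, tc f.1 ∈ Nset (m k) (n k)) ∧
        Dense {z | ∃ k, (D k (tc f.1)).eval z = 0}} := by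
  have hBaire := Hol.baireSpace hΩo
  have htc := continuous_tc hΩo h0
  set B := TopologicalSpace.countableBasis ℂ
  set E : Set ℂ → Set (Hol Ω) := fun V =>
    ⋃ k, {f | D k (tc f.1) ≠ 0 ∧ ∃ w ∈ V, (D k (tc f.1)).eval w = 0} with hE
  have hS : {f : Hol Ω | (∀ k, tc f.1 ∈ Nset (m k) (n k)) ∧
        Dense {z | ∃ k, (D k (tc f.1)).eval z = 0}} =
      (⋂ k, {f : Hol Ω | tc f.1 ∈ Nset (m k) (n k)}) ∩ ⋂ V ∈ B, E V := by
    ext f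
    simp only [Set.mem_inter_iff, Set.mem_iInter, Set.mem_ofPred_eq, hE, Set.mem_iUnion]
    refine and_congr_right fun hf => ?_
    rw [(TopologicalSpace.isBasis_countableBasis ℂ).dense_iff]
    constructor
    · intro h V hV
      obtain ⟨z, hzV, k, hz⟩ := h V hV (TopologicalSpace.nonempty_of_mem_countableBasis hV)
      exact ⟨k, hD0 k _ (hf k), z, hzV, hz⟩
    · intro h V hV _
      obtain ⟨k, -, z, hzV, hz⟩ := h V hV
      exact ⟨z, hzV, k, hz⟩
  have hNo : ∀ k, IsOpen {f : Hol Ω | tc f.1 ∈ Nset (m k) (n k)} := fun k =>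
    (isOpen_Nset (hn k)).preimage htc
  have hEo : ∀ V ∈ B, IsOpen (E V) := fun V hV => isOpen_iUnion fun k =>
    isOpen_setOf_exists_root (fun f : Hol Ω => D k (tc f.1)) (N k) (fun _ => hN k _)
      (continuous_eval_of_coeff (fun _ => hN k _) fun j => (hD k j).comp htc)
      (TopologicalSpace.isOpen_of_mem_countableBasis hV)
  have hEd : ∀ V ∈ B, Dense (E V) := by
    intro V hV
    rw [dense_iff_inter_open]
    intro O hO hOne
    obtain ⟨f, hf, k, h⟩ := hroot V (TopologicalSpace.isOpen_of_mem_countableBasis hV)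
      (TopologicalSpace.nonempty_of_mem_countableBasis hV) O hO hOne
    exact ⟨f, hf, Set.mem_iUnion.2 ⟨k, h⟩⟩
  have hBc := TopologicalSpace.countable_countableBasis ℂ
  have hG1 : IsGδ (⋂ k, {f : Hol Ω | tc f.1 ∈ Nset (m k) (n k)}) :=
    IsGδ.iInter_of_isOpen hNo
  have hG2 : IsGδ (⋂ V ∈ B, E V) := IsGδ.biInter_of_isOpen hBc hEo
  rw [hS]
  exact ⟨hG1.inter hG2, Dense.inter_of_Gδ hG1 hG2
    (dense_iInter_of_isOpen hNo fun k => dense_preimage_Nset hΩo h0 hΩsc (hn k))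
    (dense_biInter_of_isOpen hEo hBc hEd)⟩

/-- Theorem 3.3 : for a simply connected domain `Ω ∋ 0` and a sequence `(m_k, n_k)_k`
of pairs of positive integers with `(m_k)_k` unbounded, the set of `f ∈ H(Ω)` belonging
to every `𝒩_{m_k,n_k}` and whose Padé approximants have a dense set of poles (resp. of
zeros) in `ℂ` is a dense `G_δ` subset of `H(Ω)`. -/
theorem stmt_5 (Ω : Set ℂ) (hΩo : IsOpen Ω) (hΩ0 : (0 : ℂ) ∈ Ω) (hΩc : IsConnected Ω)
    (hΩsc : SimplyConnectedSpace Ω)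
    (m n : ℕ → ℕ) (hm : ∀ k, 0 < m k) (hn : ∀ k, 0 < n k)
    (hub : ∀ N : ℕ, ∃ k, N < m k) :
    (IsGδ {f : Hol Ω | (∀ k, tc f.1 ∈ Nset (m k) (n k)) ∧
        Dense (padePoles (tc f.1) m n Set.univ)} ∧
      Dense {f : Hol Ω | (∀ k, tc f.1 ∈ Nset (m k) (n k)) ∧
        Dense (padePoles (tc f.1) m n Set.univ)}) ∧
    (IsGδ {f : Hol Ω | (∀ k, tc f.1 ∈ Nset (m k) (n k)) ∧
        Dense (padeZeros (tc f.1) m n Set.univ)} ∧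
      Dense {f : Hol Ω | (∀ k, tc f.1 ∈ Nset (m k) (n k)) ∧
        Dense (padeZeros (tc f.1) m n Set.univ)}) := by
  have hP := isGδ_and_dense_of_roots hΩo hΩ0 hΩsc hn (fun k a => padeDen a (m k) (n k)) n
    (fun k a => natDegree_denPoly_le _ _) (fun k j => continuous_coeff_padeDen _ _ j)
    (fun k a h => padeDen_ne_zero h.1)
    fun V hV hVne O hO hOne => exists_padeDen_root hΩo hΩ0 hΩsc hn hub hV hVne hO hOne
  have hZ := isGδ_and_dense_of_roots hΩo hΩ0 hΩsc hn (fun k a => padeNum a (m k) (n k)) m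
    (fun k a => natDegree_numPoly_le _ _ _) (fun k j => continuous_coeff_padeNum _ _ j)
    (fun k a h => padeNum_ne_zero_of_mem_Nset (hn k) h)
    fun V hV hVne O hO hOne => exists_padeNum_root hΩo hΩ0 hΩsc hn hub hV hVne hO hOne
  have hPe : {f : Hol Ω | (∀ k, tc f.1 ∈ Nset (m k) (n k)) ∧
      Dense (padePoles (tc f.1) m n Set.univ)} =
      {f : Hol Ω | (∀ k, tc f.1 ∈ Nset (m k) (n k)) ∧
        Dense {z | ∃ k, (padeDen (tc f.1) (m k) (n k)).eval z = 0}} :=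
    Set.ext fun f => and_congr_right fun h => by rw [padePoles_eq h]
  have hZe : {f : Hol Ω | (∀ k, tc f.1 ∈ Nset (m k) (n k)) ∧
      Dense (padeZeros (tc f.1) m n Set.univ)} =
      {f : Hol Ω | (∀ k, tc f.1 ∈ Nset (m k) (n k)) ∧
        Dense {z | ∃ k, (padeNum (tc f.1) (m k) (n k)).eval z = 0}} :=
    Set.ext fun f => and_congr_right fun h => by rw [padeZeros_eq h]
  rw [hPe, hZe]
  exact ⟨hP, hZ⟩

end
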